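/- (Universal limit theorem.) For every K > 0 there exists a constant C > 0 such that the following holds: let 𝐗 and 𝐗̃ be level-2 α-Hölder rough paths over V with ‖𝐗‖_α ≤ K and ‖𝐗̃‖_α ≤ K, let F ∈ C_b^3(W, L(U,W)) with ‖F‖_{C_b^3} ≤ K, let 𝐙 = (Z,Z') be an 𝐗-controlled rough path and 𝐙̃ = (Z̃,Z̃') an 𝐗̃-controlled rough path, both with values in U, with ‖Z'_0‖, ‖Z̃'_0‖, ‖𝐙‖_{𝐗;α}, ‖𝐙̃‖_{𝐗̃;α} ≤ K. Suppose 𝐘 = (Y,Y') is an 𝐗-controlled rough path with values in W satisfying Y'_t = F(Y_t) ∘ Z'_t and Y_t = Y_0 + ∫_0^t F(Y_r) dZ_r for all t ∈ [0,T] (rough integral over 𝐗), and 𝐘̃ = (Ỹ,Ỹ') is an 𝐗̃-controlled rough path with values in W satisfying Ỹ'_t = F(Ỹ_t) ∘ Z̃'_t and Ỹ_t = Ỹ_0 + ∫_0^t F(Ỹ_r) dZ̃_r for all t ∈ [0,T] (rough integral over 𝐗̃), with ‖Y'_0‖, ‖Ỹ'_0‖, ‖𝐘‖_{𝐗;α},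 ‖𝐘̃‖_{𝐗̃;α} ≤ K. Then d_{𝐗,𝐗̃;α}(𝐘,𝐘̃) ≤ C ( ‖Y_0 − Ỹ_0‖ + ‖Y'_0 − Ỹ'_0‖ + ‖Z_0 − Z̃_0‖ + ‖Z'_0 − Z̃'_0‖ + d_{𝐗,𝐗̃;α}(𝐙,𝐙̃) + ‖𝐗 − 𝐗̃‖_α ). -/

import Mathlib

/-!  Common definitions: level-2 rough paths, controlled rough paths,
compensated Riemann sums and rough integrals of a controlled rough path
against another controlled rough path. -/

open scoped BigOperators

noncomputable section

/-- `HBound T β A` : the two-parameter map `A` satisfies a `β`-Hölder bound on the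
simplex `{0 ≤ s < t ≤ T}`. -/
def HBound {E : Type*} [NormedAddCommGroup E] (T β : ℝ) (A : ℝ → ℝ → E) : Prop :=
  ∃ C : ℝ, ∀ s t : ℝ, 0 ≤ s → s < t → t ≤ T → ‖A s t‖ ≤ C * (t - s) ^ β

/-- The Hölder seminorm `‖A‖_β = sup_{0 ≤ s < t ≤ T} ‖A_{s,t}‖ / (t-s)^β`, realised as the
least admissible Hölder constant. -/
def hnorm {E : Type*} [NormedAddCommGroup E] (T β : ℝ) (A : ℝ → ℝ → E) : ℝ :=
  sInf {C : ℝ | 0 ≤ C ∧ ∀ s t : ℝ, 0 ≤ s → s < t → t ≤ T → ‖A s t‖ ≤ C * (t - s) ^ β}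

/-- An abstract model of the projective tensor product `V ⊗̂ V`, bundling the canonical
bounded bilinear map `tmul : V × V → V ⊗̂ V` and the pairing `⋆` sending
`A ∈ L(V, L(W,U))` and `B ∈ L(V,W)` to the induced operator `A ⋆ B ∈ L(V ⊗̂ V, U)`,
characterised by `(A ⋆ B)(v₁ ⊗ v₂) = (A v₁)(B v₂)` and `‖A ⋆ B‖ ≤ ‖A‖ ‖B‖`. -/
structure TensorOps (V V2 W U : Type*)
    [NormedAddCommGroup V] [NormedSpace ℝ V] [NormedAddCommGroup V2] [NormedSpace ℝ V2]
    [NormedAddCommGroup W] [NormedSpace ℝ W] [NormedAddCommGroup U] [NormedSpace ℝ U] where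
  tmul : V →L[ℝ] V →L[ℝ] V2
  tmul_le : ∀ a b : V, ‖tmul a b‖ ≤ ‖a‖ * ‖b‖
  spair : (V →L[ℝ] (W →L[ℝ] U)) →L[ℝ] ((V →L[ℝ] W) →L[ℝ] (V2 →L[ℝ] U))
  spair_tmul : ∀ (A : V →L[ℝ] (W →L[ℝ] U)) (B : V →L[ℝ] W) (a b : V),
    spair A B (tmul a b) = (A a) (B b)
  spair_le : ∀ (A : V →L[ℝ] (W →L[ℝ] U)) (B : V →L[ℝ] W), ‖spair A B‖ ≤ ‖A‖ * ‖B‖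

section Defs

variable {V V2 E : Type*}
  [NormedAddCommGroup V] [NormedSpace ℝ V] [NormedAddCommGroup V2] [NormedSpace ℝ V2]
  [NormedAddCommGroup E] [NormedSpace ℝ E]

/-- `(X, XX)` is a level-2 `α`-Hölder rough path on `[0,T]`:
Chen's relation plus the analytic estimates. -/
structure IsRoughPath (T α : ℝ) (tmul : V →L[ℝ] V →L[ℝ] V2)
    (X : ℝ → V) (XX : ℝ → ℝ → V2) : Prop where
  chen : ∀ s u t : ℝ, 0 ≤ s → s ≤ u → u ≤ t → t ≤ T →
    XX s t = XX s u + XX u t + tmul (X u - X s) (X t - X u)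
  x_hold : HBound T α fun s t => X t - X s
  xx_hold : HBound T (2 * α) XX

/-- `‖𝐗‖_α := ‖X‖_α + ‖𝕏‖_{2α}`. -/
def rpNorm (T α : ℝ) (X : ℝ → V) (XX : ℝ → ℝ → V2) : ℝ :=
  hnorm T α (fun s t => X t - X s) + hnorm T (2 * α) XX

/-- `‖𝐗 − 𝐗̃‖_α := ‖X − X̃‖_α + ‖𝕏 − 𝕏̃‖_{2α}`. -/
def rpDist (T α : ℝ) (X Xt : ℝ → V) (XX XXt : ℝ → ℝ → V2) : ℝ :=
  hnorm T α (fun s t => (X t - X s) - (Xt t - Xt s)) +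
    hnorm T (2 * α) fun s t => XX s t - XXt s t

/-- The remainder `R^{𝐘}_{s,t} := Y_{s,t} − Y'_s(X_{s,t})` of a controlled rough path. -/
def Rem (X : ℝ → V) (Y : ℝ → E) (Y' : ℝ → V →L[ℝ] E) (s t : ℝ) : E :=
  Y t - Y s - Y' s (X t - X s)

/-- `(Y, Y')` is an `𝐗`-controlled rough path on `[0,T]` with values in `E`. -/
structure IsCRP (T α : ℝ) (X : ℝ → V) (Y : ℝ → E) (Y' : ℝ → V →L[ℝ] E) : Prop where
  deriv_hold : HBound T α fun s t => Y' t - Y' s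
  rem_hold : HBound T (2 * α) (Rem X Y Y')

/-- `‖𝐘‖_{𝐗;α} := ‖R^{𝐘}‖_{2α} + ‖Y'‖_α`. -/
def crpNorm (T α : ℝ) (X : ℝ → V) (Y : ℝ → E) (Y' : ℝ → V →L[ℝ] E) : ℝ :=
  hnorm T (2 * α) (Rem X Y Y') + hnorm T α fun s t => Y' t - Y' s

/-- `d_{𝐗,𝐗̃;α}(𝐘,𝐘̃) := ‖R^{𝐘} − R^{𝐘̃}‖_{2α} + ‖Y' − Ỹ'‖_α`. -/
def crpDist (T α : ℝ) (X Xt : ℝ → V) (Y : ℝ → E) (Y' : ℝ → V →L[ℝ] E)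
    (Yt : ℝ → E) (Yt' : ℝ → V →L[ℝ] E) : ℝ :=
  hnorm T (2 * α) (fun s t => Rem X Y Y' s t - Rem Xt Yt Yt' s t) +
    hnorm T α fun s t => (Y' t - Y' s) - (Yt' t - Yt' s)

/-- `p` is a finite partition `s = p 0 < p 1 < ⋯ < p n = t` of `[s,t]`. -/
def IsPartition (s t : ℝ) (n : ℕ) (p : ℕ → ℝ) : Prop :=
  p 0 = s ∧ p n = t ∧ ∀ i < n, p i < p (i + 1)

end Defs

section Sums

variable {V V2 W U : Type*}
  [NormedAddCommGroup V] [NormedSpace ℝ V] [NormedAddCommGroup V2] [NormedSpace ℝ V2]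
  [NormedAddCommGroup W] [NormedSpace ℝ W] [NormedAddCommGroup U] [NormedSpace ℝ U]

/-- The compensated Riemann sum
`∫_P Y dZ := Σ_i [ Y_{t_i}(Z_{t_i,t_{i+1}}) + (Y'_{t_i} ⋆ Z'_{t_i})(𝕏_{t_i,t_{i+1}}) ]`. -/
def rsum (tops : TensorOps V V2 W U) (XX : ℝ → ℝ → V2)
    (Y : ℝ → W →L[ℝ] U) (Y' : ℝ → V →L[ℝ] (W →L[ℝ] U))
    (Z : ℝ → W) (Z' : ℝ → V →L[ℝ] W) (n : ℕ) (p : ℕ → ℝ) : U :=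
  ∑ i ∈ Finset.range n,
    ((Y (p i)) (Z (p (i + 1)) - Z (p i)) +
      (tops.spair (Y' (p i)) (Z' (p i))) (XX (p i) (p (i + 1))))

/-- `I` is the rough integral `∫_s^t Y dZ`: the limit of the compensated Riemann sums
as the mesh of the partition tends to `0`. -/
def IsRoughIntegral (tops : TensorOps V V2 W U) (XX : ℝ → ℝ → V2)
    (Y : ℝ → W →L[ℝ] U) (Y' : ℝ → V →L[ℝ] (W →L[ℝ] U))
    (Z : ℝ → W) (Z' : ℝ → V →L[ℝ] W) (s t : ℝ) (I : U) : Prop :=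
  ∀ ε : ℝ, 0 < ε → ∃ δ : ℝ, 0 < δ ∧ ∀ (n : ℕ) (p : ℕ → ℝ), IsPartition s t n p →
    (∀ i < n, p (i + 1) - p i < δ) → ‖rsum tops XX Y Y' Z Z' n p - I‖ ≤ ε

end Sums

/-- The constant `C_α := (1 + T^α + T^{2α}) · 2^{3α} · Σ_{n≥1} n^{-3α}`. -/
def Calpha (T α : ℝ) : ℝ :=
  (1 + T ^ α + T ^ (2 * α)) * (2 : ℝ) ^ (3 * α) * ∑' n : ℕ, ((n : ℝ) + 1) ^ (-(3 * α))

/-- `F ∈ C_b^k`: `k` times continuously Fréchet differentiable with all derivatives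
up to order `k` bounded. -/
def IsCb {E₁ E₂ : Type*} [NormedAddCommGroup E₁] [NormedSpace ℝ E₁]
    [NormedAddCommGroup E₂] [NormedSpace ℝ E₂] (k : ℕ) (F : E₁ → E₂) : Prop :=
  ContDiff ℝ (k : ℕ∞) F ∧ ∀ j ≤ k, ∃ C : ℝ, ∀ x, ‖iteratedFDeriv ℝ j F x‖ ≤ C

/-- `‖F‖_{C_b^k} := Σ_{j=0}^k sup_x ‖D^j F(x)‖`. -/
def cbNorm {E₁ E₂ : Type*} [NormedAddCommGroup E₁] [NormedSpace ℝ E₁]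
    [NormedAddCommGroup E₂] [NormedSpace ℝ E₂] (k : ℕ) (F : E₁ → E₂) : ℝ :=
  ∑ j ∈ Finset.range (k + 1), ⨆ x : E₁, ‖iteratedFDeriv ℝ j F x‖

end

section Sewing

variable {E : Type*} [NormedAddCommGroup E]

/-- The Riemann sum of a two-parameter germ along a sequence of points. -/
def germSum (Ξ : ℝ → ℝ → E) (n : ℕ) (p : ℕ → ℝ) : E :=
  ∑ i ∈ Finset.range n, Ξ (p i) (p (i + 1))

theorem IsPartition.exists_append {s u t δ : ℝ} {n m : ℕ} {p q : ℕ → ℝ}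
    (hp : IsPartition s u n p) (hq : IsPartition u t m q)
    (hpδ : ∀ i < n, p (i + 1) - p i ≤ δ) (hqδ : ∀ i < m, q (i + 1) - q i ≤ δ) :
    ∃ r : ℕ → ℝ, IsPartition s t (n + m) r ∧ (∀ i < n + m, r (i + 1) - r i ≤ δ) ∧
      ∀ Ξ : ℝ → ℝ → E, germSum Ξ (n + m) r = germSum Ξ n p + germSum Ξ m q := by
  obtain ⟨hp0, hpn, hpi⟩ := hp
  obtain ⟨hq0, hqm, hqi⟩ := hq
  set r : ℕ → ℝ := fun i => if i ≤ n then p i else q (i - n) with hr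
  have hl : ∀ i ≤ n, r i = p i := fun i hi => by simp [hr, hi]
  have hg : ∀ j, r (n + j) = q j := by
    intro j
    rcases Nat.eq_zero_or_pos j with rfl | hj
    · simp [hr, hpn, hq0]
    · have : ¬ n + j ≤ n := by omega
      simp [hr, this]
  have key : ∀ Q : ℝ → ℝ → Prop, (∀ i < n, Q (p i) (p (i + 1))) →
      (∀ i < m, Q (q i) (q (i + 1))) → ∀ i < n + m, Q (r i) (r (i + 1)) := by
    intro Q h1 h2 i hi
    rcases lt_or_ge i n with h | h
    · rw [hl i h.le, hl (i + 1) h]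
      exact h1 i h
    · obtain ⟨j, rfl⟩ := Nat.exists_eq_add_of_le h
      rw [hg j, add_assoc, hg (j + 1)]
      exact h2 j (by omega)
  refine ⟨r, ⟨?_, ?_, key (fun x y => x < y) hpi hqi⟩,
    key (fun x y => y - x ≤ δ) hpδ hqδ, fun Ξ => ?_⟩
  · rw [hl 0 (Nat.zero_le _), hp0]
  · rw [hg m, hqm]
  · unfold germSum
    rw [Finset.sum_range_add]
    congr 1
    · refine Finset.sum_congr rfl fun i hi => ?_
      have hi := Finset.mem_range.1 hi
      rw [hl i hi.le, hl (i + 1) hi]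
    · refine Finset.sum_congr rfl fun i _ => ?_
      rw [hg i, add_assoc, hg (i + 1)]

/-- The constant in the sewing estimate with exponent `θ > 1`. -/
noncomputable def sewConst (θ : ℝ) : ℝ := (1 - 2 * (1 / 2 : ℝ) ^ θ)⁻¹

theorem two_mul_half_rpow_lt_one {θ : ℝ} (hθ : 1 < θ) : 2 * (1 / 2 : ℝ) ^ θ < 1 := by
  have h := Real.rpow_lt_rpow_of_exponent_gt (x := (1 / 2 : ℝ)) (by norm_num) (by norm_num) hθ
  rw [Real.rpow_one] at h
  linarith

theorem sewConst_nonneg {θ : ℝ} (hθ : 1 < θ) : 0 ≤ sewConst θ :=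
  inv_nonneg.2 (by linarith [two_mul_half_rpow_lt_one hθ])

theorem sewConst_fixed {θ : ℝ} (hθ : 1 < θ) :
    2 * (1 / 2 : ℝ) ^ θ * sewConst θ + 1 = sewConst θ := by
  have h : 1 - 2 * (1 / 2 : ℝ) ^ θ ≠ 0 := by linarith [two_mul_half_rpow_lt_one hθ]
  unfold sewConst
  field_simp
  ring

theorem exists_partition_germSum_le {Ξ : ℝ → ℝ → E} {a b θ M : ℝ} (hθ : 1 < θ)
    (hΞ : ∀ s u t, a ≤ s → s < u → u < t → t ≤ b →
      ‖Ξ s t - Ξ s u - Ξ u t‖ ≤ M * (t - s) ^ θ) (k : ℕ) :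
    ∀ s t, a ≤ s → s < t → t ≤ b → ∃ (n : ℕ) (p : ℕ → ℝ), IsPartition s t n p ∧
      (∀ i < n, p (i + 1) - p i ≤ (t - s) / 2 ^ k) ∧
      ‖germSum Ξ n p - Ξ s t‖ ≤ sewConst θ * M * (t - s) ^ θ := by
  induction k with
  | zero =>
    intro s t has hst htb
    have hM : 0 ≤ M * (t - s) ^ θ :=
      (norm_nonneg _).trans (hΞ s ((s + t) / 2) t has (by linarith) (by linarith) htb)
    refine ⟨1, fun i => if i = 0 then s else t, ⟨by simp, by simp, ?_⟩, ?_, ?_⟩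
    · intro i hi
      obtain rfl : i = 0 := by omega
      simpa using hst
    · intro i hi
      obtain rfl : i = 0 := by omega
      simp
    · simp only [germSum, Finset.range_one, Finset.sum_singleton, if_true]
      simp only [zero_add, one_ne_zero, if_false, sub_self, norm_zero, mul_assoc]
      exact mul_nonneg (sewConst_nonneg hθ) hM
  | succ k ih =>
    intro s t has hst htb
    set u := (s + t) / 2 with hu
    have hsu : s < u := by linarith
    have hut : u < t := by linarith
    obtain ⟨n, p, hp, hpδ, hpb⟩ := ih s u has hsu (hut.le.trans htb)
    obtain ⟨m, q, hq, hqδ, hqb⟩ := ih u t (has.trans hsu.le) hut htb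
    have e1 : u - s = (1 / 2) * (t - s) := by rw [hu]; ring
    have e2 : t - u = (1 / 2) * (t - s) := by rw [hu]; ring
    have e3 : (1 / 2) * (t - s) / 2 ^ k = (t - s) / 2 ^ (k + 1) := by
      rw [pow_succ]; field_simp
    rw [e1] at hpδ hpb
    rw [e2] at hqδ hqb
    rw [e3] at hpδ hqδ
    rw [Real.mul_rpow (by norm_num) (by linarith)] at hpb hqb
    obtain ⟨r, hr, hrδ, hrs⟩ := IsPartition.exists_append (E := E) hp hq hpδ hqδ
    refine ⟨n + m, r, hr, hrδ, ?_⟩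
    rw [hrs Ξ]
    have h3 := hΞ s u t has hsu hut htb
    have e : germSum Ξ n p + germSum Ξ m q - Ξ s t =
        (germSum Ξ n p - Ξ s u) + (germSum Ξ m q - Ξ u t) - (Ξ s t - Ξ s u - Ξ u t) := by abel
    rw [e]
    calc _ ≤ ‖germSum Ξ n p - Ξ s u‖ + ‖germSum Ξ m q - Ξ u t‖ + ‖Ξ s t - Ξ s u - Ξ u t‖ :=
          (norm_sub_le _ _).trans (by gcongr; exact norm_add_le _ _)
      _ ≤ sewConst θ * M * ((1 / 2) ^ θ * (t - s) ^ θ) +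
          sewConst θ * M * ((1 / 2) ^ θ * (t - s) ^ θ) + M * (t - s) ^ θ := by gcongr
      _ = (2 * (1 / 2 : ℝ) ^ θ * sewConst θ + 1) * M * (t - s) ^ θ := by ring
      _ = _ := by rw [sewConst_fixed hθ]

theorem exists_partition_mesh_le {s t δ : ℝ} (hst : s ≤ t) (hδ : 0 < δ) :
    ∃ (n : ℕ) (p : ℕ → ℝ), IsPartition s t n p ∧ ∀ i < n, p (i + 1) - p i ≤ δ := by
  rcases hst.eq_or_lt with rfl | hst
  · exact ⟨0, fun _ => s, ⟨rfl, rfl, by simp⟩, by simp⟩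
  · obtain ⟨k, hk⟩ := pow_unbounded_of_one_lt ((t - s) / δ) (one_lt_two (α := ℝ))
    obtain ⟨n, p, hp, hpδ, -⟩ := exists_partition_germSum_le (E := ℝ) (Ξ := fun _ _ => 0)
      (a := s) (b := t) (θ := 2) (M := 0) (by norm_num) (by simp) k s t le_rfl hst le_rfl
    refine ⟨n, p, hp, fun i hi => (hpδ i hi).trans ?_⟩
    rw [div_lt_iff₀ hδ] at hk
    rw [div_le_iff₀ (by positivity)]
    linarith

/-- The sewing estimate for a path whose increments are limits of Riemann sums. -/
theorem norm_sub_germ_le {Ξ : ℝ → ℝ → E} {g : ℝ → E} {T a b θ M : ℝ} (hθ : 1 < θ)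
    (hg : ∀ t, 0 ≤ t → t ≤ T → ∀ ε : ℝ, 0 < ε → ∃ δ : ℝ, 0 < δ ∧
      ∀ (n : ℕ) (p : ℕ → ℝ), IsPartition 0 t n p → (∀ i < n, p (i + 1) - p i < δ) →
        ‖germSum Ξ n p - (g t - g 0)‖ ≤ ε)
    (ha : 0 ≤ a) (hb : b ≤ T)
    (hΞ : ∀ s u t, a ≤ s → s < u → u < t → t ≤ b →
      ‖Ξ s t - Ξ s u - Ξ u t‖ ≤ M * (t - s) ^ θ)
    {s t : ℝ} (has : a ≤ s) (hst : s < t) (htb : t ≤ b) :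
    ‖g t - g s - Ξ s t‖ ≤ sewConst θ * M * (t - s) ^ θ := by
  refine le_of_forall_pos_le_add fun ε hε => ?_
  obtain ⟨δ₁, hδ₁, h₁⟩ := hg s (by linarith) (by linarith) (ε / 2) (by linarith)
  obtain ⟨δ₂, hδ₂, h₂⟩ := hg t (by linarith) (by linarith) (ε / 2) (by linarith)
  set δ := min δ₁ δ₂ / 2 with hδdef
  have hδ : 0 < δ := by positivity
  have hd1 : δ < δ₁ := by have := min_le_left δ₁ δ₂; linarith
  have hd2 : δ < δ₂ := by have := min_le_right δ₁ δ₂; linarith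
  obtain ⟨n, p, hp, hpδ⟩ := exists_partition_mesh_le (s := 0) (t := s) (by linarith) hδ
  obtain ⟨k, hk⟩ := pow_unbounded_of_one_lt ((t - s) / δ) (one_lt_two (α := ℝ))
  obtain ⟨m, q, hq, hqδ, hqb⟩ := exists_partition_germSum_le hθ hΞ k s t has hst htb
  have hqδ' : ∀ i < m, q (i + 1) - q i ≤ δ := by
    refine fun i hi => (hqδ i hi).trans ?_
    rw [div_lt_iff₀ hδ] at hk
    rw [div_le_iff₀ (by positivity)]
    linarith
  obtain ⟨r, hr, hrδ, hrs⟩ := IsPartition.exists_append (E := E) hp hq hpδ hqδ'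
  have i1 := h₁ n p hp fun i hi => (hpδ i hi).trans_lt hd1
  have i2 := h₂ (n + m) r hr fun i hi => (hrδ i hi).trans_lt hd2
  rw [hrs Ξ] at i2
  have e : g t - g s - Ξ s t = (germSum Ξ n p - (g s - g 0)) -
      (germSum Ξ n p + germSum Ξ m q - (g t - g 0)) + (germSum Ξ m q - Ξ s t) := by abel
  rw [e]
  refine (norm_add_le _ _).trans ?_
  have := norm_sub_le (germSum Ξ n p - (g s - g 0))
    (germSum Ξ n p + germSum Ξ m q - (g t - g 0))
  linarith

end Sewing

section PairBound

variable {E E₁ E₂ : Type*} [NormedAddCommGroup E] [NormedAddCommGroup E₁] [NormedAddCommGroup E₂]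

/-- Two vectors of size at most `M * ρ` whose difference has size at most `M * d * ρ`. -/
def PairBound (M d ρ : ℝ) (x y : E) : Prop :=
  ‖x‖ ≤ M * ρ ∧ ‖y‖ ≤ M * ρ ∧ ‖x - y‖ ≤ M * d * ρ

namespace PairBound

variable {M N d d' ρ σ : ℝ}

theorem add {x y x' y' : E} (h : PairBound M d ρ x y) (h' : PairBound N d ρ x' y') :
    PairBound (M + N) d ρ (x + x') (y + y') := by
  obtain ⟨h1, h2, h3⟩ := h
  obtain ⟨k1, k2, k3⟩ := h'
  refine ⟨(norm_add_le _ _).trans (by linarith), (norm_add_le _ _).trans (by linarith), ?_⟩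
  rw [add_sub_add_comm]
  exact (norm_add_le _ _).trans (by linarith)

theorem neg {x y : E} (h : PairBound M d ρ x y) : PairBound M d ρ (-x) (-y) := by
  obtain ⟨h1, h2, h3⟩ := h
  refine ⟨by rwa [norm_neg], by rwa [norm_neg], ?_⟩
  rwa [← neg_sub', norm_neg]

theorem map₂ {op : E → E₁ → E₂} (hop : ∀ x y, ‖op x y‖ ≤ ‖x‖ * ‖y‖)
    (hsub : ∀ x y x' y', op x y - op x' y' = op (x - x') y + op x' (y - y'))
    {x x' : E} {y y' : E₁} (h : PairBound M d ρ x x') (h' : PairBound N d σ y y') :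
    PairBound (2 * M * N) d (ρ * σ) (op x y) (op x' y') := by
  obtain ⟨h1, h2, h3⟩ := h
  obtain ⟨k1, k2, k3⟩ := h'
  have m0 := (norm_nonneg _).trans h1
  have n0 := (norm_nonneg _).trans k1
  have md0 := (norm_nonneg _).trans h3
  have p0 := mul_nonneg m0 n0
  refine ⟨(hop _ _).trans ((mul_le_mul h1 k1 (norm_nonneg _) m0).trans (by nlinarith)),
    (hop _ _).trans ((mul_le_mul h2 k2 (norm_nonneg _) m0).trans (by nlinarith)), ?_⟩
  rw [hsub]
  refine (norm_add_le _ _).trans ((add_le_add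
    ((hop _ _).trans (mul_le_mul h3 k1 (norm_nonneg _) md0))
    ((hop _ _).trans (mul_le_mul h2 k3 (norm_nonneg _) m0))).trans (le_of_eq (by ring)))

theorem mono_dist {x y : E} (h : PairBound M d ρ x y) (hM : 0 ≤ M) (hρ : 0 ≤ ρ) (hd : d ≤ d') :
    PairBound M d' ρ x y :=
  ⟨h.1, h.2.1, h.2.2.trans (by gcongr)⟩

theorem mono_scale {x y : E} (h : PairBound M d ρ x y) (hM : 0 ≤ M) (hd : 0 ≤ d) (hρ : ρ ≤ σ) :
    PairBound M d σ x y :=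
  ⟨h.1.trans (by gcongr), h.2.1.trans (by gcongr), h.2.2.trans (by gcongr)⟩

theorem of_lipschitz {G : E → E₁} (hG : ∀ x, ‖G x‖ ≤ M) (hM : 0 ≤ M)
    (hL : ∀ x y, ‖G x - G y‖ ≤ M * ‖x - y‖) {x y : E} (h : ‖x - y‖ ≤ d) :
    PairBound M d 1 (G x) (G y) :=
  ⟨by simpa using hG x, by simpa using hG y,
    by simpa using (hL x y).trans (mul_le_mul_of_nonneg_left h hM)⟩

variable [NormedSpace ℝ E] [NormedSpace ℝ E₁] [NormedSpace ℝ E₂]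

theorem apply {A A' : E →L[ℝ] E₁} {x x' : E} (h : PairBound M d ρ A A')
    (h' : PairBound N d σ x x') : PairBound (2 * M * N) d (ρ * σ) (A x) (A' x') :=
  map₂ (op := fun (A : E →L[ℝ] E₁) x => A x) (fun A x => A.le_opNorm x)
    (fun A x A' x' => by simp) h h'

theorem comp {A A' : E₁ →L[ℝ] E₂} {B B' : E →L[ℝ] E₁} (h : PairBound M d ρ A A')
    (h' : PairBound N d σ B B') : PairBound (2 * M * N) d (ρ * σ) (A.comp B) (A'.comp B') :=
  map₂ (op := fun (A : E₁ →L[ℝ] E₂) (B : E →L[ℝ] E₁) => A.comp B)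
    (fun A B => A.opNorm_comp_le B) (fun A x A' x' => by ext; simp) h h'

theorem smul {x y : E} (h : PairBound M d ρ x y) {c : ℝ} (h0 : 0 ≤ c) (h1 : c ≤ 1) :
    PairBound M d ρ (c • x) (c • y) := by
  have key : ∀ z : E, ‖c • z‖ ≤ ‖z‖ := fun z => by
    rw [norm_smul, Real.norm_of_nonneg h0]
    exact mul_le_of_le_one_left (norm_nonneg _) h1
  refine ⟨(key _).trans h.1, (key _).trans h.2.1, ?_⟩
  rw [← smul_sub]
  exact (key _).trans h.2.2

theorem of_hasDerivAt {f g f' g' : ℝ → E} (hf : ∀ θ, HasDerivAt f (f' θ) θ)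
    (hg : ∀ θ, HasDerivAt g (g' θ) θ)
    (h : ∀ θ, 0 ≤ θ → θ ≤ 1 → PairBound M d ρ (f' θ) (g' θ)) :
    PairBound M d ρ (f 1 - f 0) (g 1 - g 0) := by
  refine ⟨norm_image_sub_le_of_norm_deriv_le_segment_01' (fun x _ => (hf x).hasDerivWithinAt)
      fun x hx => (h x hx.1 hx.2.le).1,
    norm_image_sub_le_of_norm_deriv_le_segment_01' (fun x _ => (hg x).hasDerivWithinAt)
      fun x hx => (h x hx.1 hx.2.le).2.1, ?_⟩
  rw [sub_sub_sub_comm]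
  exact norm_image_sub_le_of_norm_deriv_le_segment_01' (f := fun x => f x - g x)
    (fun x _ => ((hf x).sub (hg x)).hasDerivWithinAt) fun x hx => (h x hx.1 hx.2.le).2.2

end PairBound

variable [NormedSpace ℝ E] [NormedSpace ℝ E₁] [NormedSpace ℝ E₂]

/-- `G` is differentiable with derivative bounded by `M` and `M`-Lipschitz. -/
structure LipDeriv (M : ℝ) (G : E → E₁) : Prop where
  diff : Differentiable ℝ G
  bound : ∀ x, ‖fderiv ℝ G x‖ ≤ M
  lip : ∀ x y, ‖fderiv ℝ G x - fderiv ℝ G y‖ ≤ M * ‖x - y‖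

theorem norm_segment_sub_le {x y x' y' : E} {d θ : ℝ} (hx : ‖x - x'‖ ≤ d) (hy : ‖y - y'‖ ≤ d)
    (h0 : 0 ≤ θ) (h1 : θ ≤ 1) : ‖x + θ • (y - x) - (x' + θ • (y' - x'))‖ ≤ d := by
  have e : x + θ • (y - x) - (x' + θ • (y' - x')) = (1 - θ) • (x - x') + θ • (y - y') := by
    module
  rw [e]
  refine (norm_add_le _ _).trans ?_
  rw [norm_smul, norm_smul, Real.norm_of_nonneg h0, Real.norm_of_nonneg (by linarith)]
  nlinarith

theorem LipDeriv.hasDerivAt_segment {M : ℝ} {G : E → E₁} (hG : LipDeriv M G) (x v : E) (θ : ℝ) :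
    HasDerivAt (fun θ : ℝ => G (x + θ • v)) (fderiv ℝ G (x + θ • v) v) θ := by
  have h : HasDerivAt (fun θ : ℝ => x + θ • v) v θ := by
    simpa using ((hasDerivAt_id θ).smul_const v).const_add x
  exact (hG.diff _).hasFDerivAt.comp_hasDerivAt θ h

theorem LipDeriv.pairBound_increment {M N d ρ : ℝ} {G : E → E₁} (hG : LipDeriv M G) (hM : 0 ≤ M)
    {x y x' y' : E} (hx : ‖x - x'‖ ≤ d) (hy : ‖y - y'‖ ≤ d)
    (h : PairBound N d ρ (y - x) (y' - x')) :
    PairBound (2 * M * N) d ρ (G y - G x) (G y' - G x') := by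
  have := PairBound.of_hasDerivAt (M := 2 * M * N) (d := d) (ρ := 1 * ρ)
    (hG.hasDerivAt_segment x (y - x)) (hG.hasDerivAt_segment x' (y' - x')) fun θ h0 h1 =>
      (PairBound.of_lipschitz hG.bound hM hG.lip (norm_segment_sub_le hx hy h0 h1)).apply h
  simpa using this

theorem LipDeriv.pairBound_taylor {M N d ρ : ℝ} {G : E → E₁} (hG : LipDeriv M G)
    (hG' : LipDeriv M (fderiv ℝ G)) (hM : 0 ≤ M)
    {x y x' y' : E} (hx : ‖x - x'‖ ≤ d) (hy : ‖y - y'‖ ≤ d)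
    (h : PairBound N d ρ (y - x) (y' - x')) :
    PairBound (2 * (2 * M * N) * N) d (ρ * ρ) (G y - G x - fderiv ℝ G x (y - x))
      (G y' - G x' - fderiv ℝ G x' (y' - x')) := by
  have hder : ∀ (x v : E) (θ : ℝ), HasDerivAt (fun θ : ℝ => G (x + θ • v) - θ • fderiv ℝ G x v)
      ((fderiv ℝ G (x + θ • v) - fderiv ℝ G x) v) θ := fun x v θ => by
    simpa using (hG.hasDerivAt_segment x v θ).fun_sub
      ((hasDerivAt_id θ).smul_const (fderiv ℝ G x v))
  have := PairBound.of_hasDerivAt (M := 2 * (2 * M * N) * N) (d := d) (ρ := ρ * ρ)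
    (hder x (y - x)) (hder x' (y' - x')) fun θ h0 h1 => by
      refine PairBound.apply ?_ h
      refine hG'.pairBound_increment hM hx (norm_segment_sub_le hx hy h0 h1) ?_
      simpa using h.smul h0 h1
  simpa [sub_right_comm] using this

end PairBound
section Germ

variable {V V2 W U : Type*}
  [NormedAddCommGroup V] [NormedSpace ℝ V] [NormedAddCommGroup V2] [NormedSpace ℝ V2]
  [NormedAddCommGroup W] [NormedSpace ℝ W] [NormedAddCommGroup U] [NormedSpace ℝ U]

/-- The summand of the compensated Riemann sums. -/
noncomputable def roughGerm (tops : TensorOps V V2 W U) (XX : ℝ → ℝ → V2)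
    (Y : ℝ → W →L[ℝ] U) (Y' : ℝ → V →L[ℝ] (W →L[ℝ] U))
    (Z : ℝ → W) (Z' : ℝ → V →L[ℝ] W) (s t : ℝ) : U :=
  Y s (Z t - Z s) + tops.spair (Y' s) (Z' s) (XX s t)

theorem rsum_eq_germSum (tops : TensorOps V V2 W U) (XX : ℝ → ℝ → V2)
    (Y : ℝ → W →L[ℝ] U) (Y' : ℝ → V →L[ℝ] (W →L[ℝ] U))
    (Z : ℝ → W) (Z' : ℝ → V →L[ℝ] W) (n : ℕ) (p : ℕ → ℝ) :
    rsum tops XX Y Y' Z Z' n p = germSum (roughGerm tops XX Y Y' Z Z') n p := rfl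

theorem roughGerm_sub_sub (tops : TensorOps V V2 W U) {X : ℝ → V} {XX : ℝ → ℝ → V2}
    (Y : ℝ → W →L[ℝ] U) (Y' : ℝ → V →L[ℝ] (W →L[ℝ] U))
    (Z : ℝ → W) (Z' : ℝ → V →L[ℝ] W) {s u t : ℝ}
    (hXX : XX s t = XX s u + XX u t + tops.tmul (X u - X s) (X t - X u)) :
    roughGerm tops XX Y Y' Z Z' s t - roughGerm tops XX Y Y' Z Z' s u -
        roughGerm tops XX Y Y' Z Z' u t =
      -((Y u - Y s) (Rem X Z Z' u t) + (Y u - Y s) ((Z' u - Z' s) (X t - X u)) +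
        (Rem X Y Y' s u) (Z' s (X t - X u)) +
        (tops.spair (Y' u) (Z' u) - tops.spair (Y' s) (Z' s)) (XX u t)) := by
  simp only [roughGerm, Rem, hXX, map_add, tops.spair_tmul, sub_apply, map_sub]
  abel

theorem PairBound.spair (tops : TensorOps V V2 W U) {M N d ρ σ : ℝ}
    {A A' : V →L[ℝ] (W →L[ℝ] U)} {B B' : V →L[ℝ] W}
    (h : PairBound M d ρ A A') (h' : PairBound N d σ B B') :
    PairBound (2 * M * N) d (ρ * σ) (tops.spair A B) (tops.spair A' B') :=
  PairBound.map₂ (op := fun A B => tops.spair A B) tops.spair_le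
    (fun A B A' B' => by simp) h h'

theorem PairBound.roughGerm_sub_sub (tops : TensorOps V V2 W U) {X Xt : ℝ → V}
    {XX XXt : ℝ → ℝ → V2} {Y Yt : ℝ → W →L[ℝ] U} {Y' Yt' : ℝ → V →L[ℝ] (W →L[ℝ] U)}
    {Z Zt : ℝ → W} {Z' Zt' : ℝ → V →L[ℝ] W} {s u t M a₁ a₂ a₃ d ρ : ℝ}
    (hXX : XX s t = XX s u + XX u t + tops.tmul (X u - X s) (X t - X u))
    (hXXt : XXt s t = XXt s u + XXt u t + tops.tmul (Xt u - Xt s) (Xt t - Xt u))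
    (hx : PairBound M d ρ (X t - X u) (Xt t - Xt u))
    (hxx : PairBound M d (ρ * ρ) (XX u t) (XXt u t))
    (hz : PairBound M d 1 (Z' s) (Zt' s))
    (hz' : PairBound M d ρ (Z' u - Z' s) (Zt' u - Zt' s))
    (hzr : PairBound M d (ρ * ρ) (Rem X Z Z' u t) (Rem Xt Zt Zt' u t))
    (hy : PairBound a₁ d ρ (Y u - Y s) (Yt u - Yt s))
    (hyr : PairBound a₂ d (ρ * ρ) (Rem X Y Y' s u) (Rem Xt Yt Yt' s u))
    (hp : PairBound a₃ d ρ (tops.spair (Y' u) (Z' u) - tops.spair (Y' s) (Z' s))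
      (tops.spair (Yt' u) (Zt' u) - tops.spair (Yt' s) (Zt' s))) :
    PairBound (2 * a₁ * M + 2 * a₁ * (2 * M * M) + 2 * a₂ * (2 * M * M) + 2 * a₃ * M) d
      (ρ * (ρ * ρ))
      (roughGerm tops XX Y Y' Z Z' s t - roughGerm tops XX Y Y' Z Z' s u -
        roughGerm tops XX Y Y' Z Z' u t)
      (roughGerm tops XXt Yt Yt' Zt Zt' s t - roughGerm tops XXt Yt Yt' Zt Zt' s u -
        roughGerm tops XXt Yt Yt' Zt Zt' u t) := by
  rw [_root_.roughGerm_sub_sub tops Y Y' Z Z' hXX, _root_.roughGerm_sub_sub tops Yt Yt' Zt Zt' hXXt]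
  have h3 := hyr.apply (hz.apply hx)
  rw [one_mul, mul_assoc ρ ρ ρ] at h3
  exact (((hy.apply hzr).add (hy.apply (hz'.apply hx))).add h3).add (hp.apply hxx) |>.neg

end Germ

section LocalEstimate

variable {V V2 W U : Type*}
  [NormedAddCommGroup V] [NormedSpace ℝ V] [NormedAddCommGroup V2] [NormedSpace ℝ V2]
  [NormedAddCommGroup W] [NormedSpace ℝ W] [NormedAddCommGroup U] [NormedSpace ℝ U]

/-- Size and closeness bounds for two rough paths together with controlled drivers. -/
structure DriverPair (T α M e : ℝ) (X Xt : ℝ → V) (XX XXt : ℝ → ℝ → V2)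
    (Z Zt : ℝ → U) (Z' Zt' : ℝ → V →L[ℝ] U) : Prop where
  path : ∀ s t, 0 ≤ s → s < t → t ≤ T →
    PairBound M e ((t - s) ^ α) (X t - X s) (Xt t - Xt s)
  area : ∀ s t, 0 ≤ s → s < t → t ≤ T →
    PairBound M e ((t - s) ^ α * (t - s) ^ α) (XX s t) (XXt s t)
  deriv : ∀ s, 0 ≤ s → s ≤ T → PairBound M e 1 (Z' s) (Zt' s)
  deriv_inc : ∀ s t, 0 ≤ s → s < t → t ≤ T →
    PairBound M e ((t - s) ^ α) (Z' t - Z' s) (Zt' t - Zt' s)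
  rem : ∀ s t, 0 ≤ s → s < t → t ≤ T →
    PairBound M e ((t - s) ^ α * (t - s) ^ α) (Rem X Z Z' s t) (Rem Xt Zt Zt' s t)

omit [NormedSpace ℝ V2] in
theorem DriverPair.mono {T α M e e' : ℝ} {X Xt : ℝ → V} {XX XXt : ℝ → ℝ → V2}
    {Z Zt : ℝ → U} {Z' Zt' : ℝ → V →L[ℝ] U}
    (h : DriverPair T α M e X Xt XX XXt Z Zt Z' Zt') (hM : 0 ≤ M) (he : e ≤ e') :
    DriverPair T α M e' X Xt XX XXt Z Zt Z' Zt' where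
  path s t h0 hst hT := (h.path s t h0 hst hT).mono_dist hM
    (Real.rpow_nonneg (sub_nonneg.2 hst.le) _) he
  area s t h0 hst hT := (h.area s t h0 hst hT).mono_dist hM (mul_self_nonneg _) he
  deriv s h0 hT := (h.deriv s h0 hT).mono_dist hM zero_le_one he
  deriv_inc s t h0 hst hT := (h.deriv_inc s t h0 hst hT).mono_dist hM
    (Real.rpow_nonneg (sub_nonneg.2 hst.le) _) he
  rem s t h0 hst hT := (h.rem s t h0 hst hT).mono_dist hM (mul_self_nonneg _) he

/-- A pair of solutions of the rough differential equation, with a priori bounds. -/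
structure SolutionPair (T α M : ℝ) (tops : TensorOps V V2 U W) (F : W → U →L[ℝ] W)
    (X Xt : ℝ → V) (XX XXt : ℝ → ℝ → V2) (Z Zt : ℝ → U) (Z' Zt' : ℝ → V →L[ℝ] U)
    (Y Yt : ℝ → W) (Y' Yt' : ℝ → V →L[ℝ] W) : Prop where
  chen : ∀ s u t : ℝ, 0 ≤ s → s ≤ u → u ≤ t → t ≤ T →
    XX s t = XX s u + XX u t + tops.tmul (X u - X s) (X t - X u)
  chen_t : ∀ s u t : ℝ, 0 ≤ s → s ≤ u → u ≤ t → t ≤ T →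
    XXt s t = XXt s u + XXt u t + tops.tmul (Xt u - Xt s) (Xt t - Xt u)
  deriv_eq : ∀ t : ℝ, 0 ≤ t → t ≤ T → Y' t = (F (Y t)).comp (Z' t)
  deriv_eq_t : ∀ t : ℝ, 0 ≤ t → t ≤ T → Yt' t = (F (Yt t)).comp (Zt' t)
  integral : ∀ t : ℝ, 0 ≤ t → t ≤ T → IsRoughIntegral tops XX (fun r => F (Y r))
    (fun r => (fderiv ℝ F (Y r)).comp (Y' r)) Z Z' 0 t (Y t - Y 0)
  integral_t : ∀ t : ℝ, 0 ≤ t → t ≤ T → IsRoughIntegral tops XXt (fun r => F (Yt r))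
    (fun r => (fderiv ℝ F (Yt r)).comp (Yt' r)) Zt Zt' 0 t (Yt t - Yt 0)
  inc : ∀ s t, 0 ≤ s → s < t → t ≤ T → ‖Y t - Y s‖ ≤ M * (t - s) ^ α
  inc_t : ∀ s t, 0 ≤ s → s < t → t ≤ T → ‖Yt t - Yt s‖ ≤ M * (t - s) ^ α
  rem : ∀ s t, 0 ≤ s → s < t → t ≤ T → ‖Rem X Y Y' s t‖ ≤ M * ((t - s) ^ α * (t - s) ^ α)
  rem_t : ∀ s t, 0 ≤ s → s < t → t ≤ T →
    ‖Rem Xt Yt Yt' s t‖ ≤ M * ((t - s) ^ α * (t - s) ^ α)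

/-- The controlled paths `(Y, Y')` and `(Yt, Yt')` are `L`-close on `[a, b]`. -/
structure CloseOn (a b α L : ℝ) (X Xt : ℝ → V) (Y Yt : ℝ → W) (Y' Yt' : ℝ → V →L[ℝ] W) :
    Prop where
  inc : ∀ s t, a ≤ s → s < t → t ≤ b → ‖(Y t - Y s) - (Yt t - Yt s)‖ ≤ L * (t - s) ^ α
  deriv : ∀ s t, a ≤ s → s < t → t ≤ b → ‖(Y' t - Y' s) - (Yt' t - Yt' s)‖ ≤ L * (t - s) ^ α
  rem : ∀ s t, a ≤ s → s < t → t ≤ b →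
    ‖Rem X Y Y' s t - Rem Xt Yt Yt' s t‖ ≤ L * ((t - s) ^ α * (t - s) ^ α)

/-- Constant for the increments of the solution. -/
def incConst (M : ℝ) : ℝ := M + 1 + 2 * (2 * M * M) * M

/-- Constant for the increments of the Gubinelli derivative of the solution. -/
def derivConst (M : ℝ) : ℝ := 2 * (2 * M * incConst M) * M + 2 * M * M

/-- Constant for the increments of the Gubinelli derivative of the integrand. -/
def integrandConst (M : ℝ) : ℝ :=
  2 * (2 * M * incConst M) * (2 * M * M) + 2 * M * derivConst M

/-- Constant for the coefficient of the second order term. -/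
def pairingConst (M : ℝ) : ℝ :=
  2 * integrandConst M * M + 2 * (2 * M * (2 * M * M)) * M

/-- Constant for the remainder of the integrand. -/
def remConst (M : ℝ) : ℝ :=
  2 * (2 * M * incConst M) * incConst M + 2 * M * M

/-- Constant for the defect of additivity of the germ. -/
def defectConst (M : ℝ) : ℝ :=
  2 * (2 * M * incConst M) * M + 2 * (2 * M * incConst M) * (2 * M * M) +
    2 * remConst M * (2 * M * M) + 2 * pairingConst M * M

/-- Constant of the one-step improvement of closeness. -/
noncomputable def stepConst (α M : ℝ) : ℝ :=
  incConst M + derivConst M + (sewConst (3 * α) * defectConst M + 2 * M * M +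
    2 * (2 * (2 * M * (2 * M * M)) * M) * M)

theorem incConst_nonneg {M : ℝ} (hM : 0 ≤ M) : 0 ≤ incConst M := by
  unfold incConst; positivity

theorem derivConst_nonneg {M : ℝ} (hM : 0 ≤ M) : 0 ≤ derivConst M := by
  have := incConst_nonneg hM
  unfold derivConst; positivity

theorem defectConst_nonneg {M : ℝ} (hM : 0 ≤ M) : 0 ≤ defectConst M := by
  have := incConst_nonneg hM
  have := derivConst_nonneg hM
  unfold defectConst remConst pairingConst integrandConst; positivity

theorem stepConst_nonneg {α M : ℝ} (hα : 1 / 3 < α) (hM : 0 ≤ M) : 0 ≤ stepConst α M := by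
  have := incConst_nonneg hM
  have := derivConst_nonneg hM
  have := defectConst_nonneg hM
  have := sewConst_nonneg (θ := 3 * α) (by linarith)
  unfold stepConst; positivity

theorem rpow_three_mul {r α : ℝ} (hr : 0 < r) : r ^ (3 * α) = r ^ α * (r ^ α * r ^ α) := by
  rw [← Real.rpow_add hr, ← Real.rpow_add hr]; ring_nf

theorem rpow_two_mul {r α : ℝ} (hr : 0 < r) : r ^ (2 * α) = r ^ α * r ^ α := by
  rw [← Real.rpow_add hr]; ring_nf

theorem SolutionPair.norm_increment_sub_germ_le {T α M a b D : ℝ} {tops : TensorOps V V2 U W}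
    {F : W → U →L[ℝ] W} {X Xt : ℝ → V} {XX XXt : ℝ → ℝ → V2} {Z Zt : ℝ → U}
    {Z' Zt' : ℝ → V →L[ℝ] U} {Y Yt : ℝ → W} {Y' Yt' : ℝ → V →L[ℝ] W}
    (h : SolutionPair T α M tops F X Xt XX XXt Z Zt Z' Zt' Y Yt Y' Yt')
    (hα : 1 / 3 < α) (ha : 0 ≤ a) (hb : b ≤ T)
    (hD : ∀ s u t, a ≤ s → s < u → u < t → t ≤ b →
      ‖(roughGerm tops XX (fun r => F (Y r)) (fun r => (fderiv ℝ F (Y r)).comp (Y' r)) Z Z' s t -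
        roughGerm tops XX (fun r => F (Y r)) (fun r => (fderiv ℝ F (Y r)).comp (Y' r)) Z Z' s u -
        roughGerm tops XX (fun r => F (Y r)) (fun r => (fderiv ℝ F (Y r)).comp (Y' r)) Z Z' u t) -
       (roughGerm tops XXt (fun r => F (Yt r)) (fun r => (fderiv ℝ F (Yt r)).comp (Yt' r)) Zt Zt'
          s t -
        roughGerm tops XXt (fun r => F (Yt r)) (fun r => (fderiv ℝ F (Yt r)).comp (Yt' r)) Zt Zt'
          s u -
        roughGerm tops XXt (fun r => F (Yt r)) (fun r => (fderiv ℝ F (Yt r)).comp (Yt' r)) Zt Zt'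
          u t)‖
      ≤ D * ((t - s) ^ α * ((t - s) ^ α * (t - s) ^ α)))
    {s t : ℝ} (has : a ≤ s) (hst : s < t) (htb : t ≤ b) :
    ‖(Y t - Y s - roughGerm tops XX (fun r => F (Y r))
        (fun r => (fderiv ℝ F (Y r)).comp (Y' r)) Z Z' s t) -
      (Yt t - Yt s - roughGerm tops XXt (fun r => F (Yt r))
        (fun r => (fderiv ℝ F (Yt r)).comp (Yt' r)) Zt Zt' s t)‖ ≤
      sewConst (3 * α) * D * ((t - s) ^ α * ((t - s) ^ α * (t - s) ^ α)) := by
  set Ξ := roughGerm tops XX (fun r => F (Y r)) (fun r => (fderiv ℝ F (Y r)).comp (Y' r)) Z Z'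
    with hΞ
  set Ξt := roughGerm tops XXt (fun r => F (Yt r)) (fun r => (fderiv ℝ F (Yt r)).comp (Yt' r))
    Zt Zt' with hΞt
  have key := norm_sub_germ_le (Ξ := fun s t => Ξ s t - Ξt s t) (g := fun t => Y t - Yt t)
    (T := T) (a := a) (b := b) (θ := 3 * α) (M := D) (by linarith) ?_ ha hb ?_ has hst htb
  · rw [← rpow_three_mul (sub_pos.2 hst)]
    convert key using 2
    abel
  · intro t ht0 htT ε hε
    obtain ⟨δ₁, hδ₁, h₁⟩ := h.integral t ht0 htT (ε / 2) (by linarith)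
    obtain ⟨δ₂, hδ₂, h₂⟩ := h.integral_t t ht0 htT (ε / 2) (by linarith)
    refine ⟨min δ₁ δ₂, lt_min hδ₁ hδ₂, fun n p hp hpδ => ?_⟩
    have i₁ := h₁ n p hp fun i hi => (hpδ i hi).trans_le (min_le_left _ _)
    have i₂ := h₂ n p hp fun i hi => (hpδ i hi).trans_le (min_le_right _ _)
    rw [rsum_eq_germSum, ← hΞ] at i₁
    rw [rsum_eq_germSum, ← hΞt] at i₂
    have e : germSum (fun s t => Ξ s t - Ξt s t) n p - (Y t - Yt t - (Y 0 - Yt 0)) =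
        (germSum Ξ n p - (Y t - Y 0)) - (germSum Ξt n p - (Yt t - Yt 0)) := by
      simp only [germSum, Finset.sum_sub_distrib]; abel
    rw [e]
    exact (norm_sub_le _ _).trans (by linarith)
  · intro s u t has hsu hut htb
    rw [rpow_three_mul (by linarith)]
    convert hD s u t has hsu hut htb using 2
    abel

theorem LipDeriv.norm_sub_le {E E₁ : Type*} [NormedAddCommGroup E] [NormedSpace ℝ E]
    [NormedAddCommGroup E₁] [NormedSpace ℝ E₁] {M : ℝ} {G : E → E₁} (hG : LipDeriv M G) (x y : E) :
    ‖G x - G y‖ ≤ M * ‖x - y‖ :=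
  convex_univ.norm_image_sub_le_of_norm_fderiv_le (fun x _ => hG.diff x) (fun x _ => hG.bound x)
    (Set.mem_univ y) (Set.mem_univ x)

set_option maxHeartbeats 1000000 in
theorem SolutionPair.closeOn_step {T α M a b e η L : ℝ} {tops : TensorOps V V2 U W}
    {F : W → U →L[ℝ] W} {X Xt : ℝ → V} {XX XXt : ℝ → ℝ → V2} {Z Zt : ℝ → U}
    {Z' Zt' : ℝ → V →L[ℝ] U} {Y Yt : ℝ → W} {Y' Yt' : ℝ → V →L[ℝ] W}
    (h : SolutionPair T α M tops F X Xt XX XXt Z Zt Z' Zt' Y Yt Y' Yt')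
    (hd : DriverPair T α M e X Xt XX XXt Z Zt Z' Zt')
    (hF₀ : ∀ x, ‖F x‖ ≤ M) (hF : LipDeriv M F) (hF' : LipDeriv M (fderiv ℝ F))
    (hα : 1 / 3 < α) (hM : 1 ≤ M) (ha : 0 ≤ a) (hb : b ≤ T)
    (hη : (b - a) ^ α ≤ η) (hη₀ : 0 ≤ η) (hη₁ : η ≤ 1) (hya : ‖Y a - Yt a‖ ≤ e) (hL : 0 ≤ L)
    (hc : CloseOn a b α L X Xt Y Yt Y' Yt') :
    CloseOn a b α (stepConst α M * (e + η * L)) X Xt Y Yt Y' Yt' := by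
  have hM0 : 0 ≤ M := by linarith
  have he : 0 ≤ e := (norm_nonneg _).trans hya
  set d := e + η * L with hd_def
  have hd0 : 0 ≤ d := by positivity
  have hed : e ≤ d := by have := mul_nonneg hη₀ hL; linarith
  have hdl : d ≤ e + L := by have := mul_le_of_le_one_left hL hη₁; linarith
  have hdr := hd.mono hM0 hed
  have hpow : ∀ s t, a ≤ s → s < t → t ≤ b → (t - s) ^ α ≤ η := fun s t h1 h2 h3 =>
    (Real.rpow_le_rpow (by linarith) (by linarith) (by linarith)).trans hη
  have hρ0 : ∀ s t : ℝ, s < t → 0 ≤ (t - s) ^ α := fun s t hst =>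
    Real.rpow_nonneg (by linarith) _
  have hy : ∀ s, a ≤ s → s ≤ b → ‖Y s - Yt s‖ ≤ d := by
    intro s h1 h2
    rcases h1.eq_or_lt with rfl | h1
    · exact hya.trans hed
    · have i1 := hc.inc a s le_rfl h1 h2
      have i2 := mul_le_mul_of_nonneg_left (hpow a s le_rfl h1 h2) hL
      have e1 : Y s - Yt s = (Y a - Yt a) + (Y s - Y a - (Yt s - Yt a)) := by abel
      rw [e1]
      exact (norm_add_le _ _).trans (by linarith)
  have hFv : ∀ s, a ≤ s → s ≤ b → PairBound M d 1 (F (Y s)) (F (Yt s)) := fun s h1 h2 =>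
    PairBound.of_lipschitz hF₀ hM0 hF.norm_sub_le (hy s h1 h2)
  have hDF : ∀ s, a ≤ s → s ≤ b →
      PairBound M d 1 (fderiv ℝ F (Y s)) (fderiv ℝ F (Yt s)) := fun s h1 h2 =>
    PairBound.of_lipschitz hF.bound hM0 hF.lip (hy s h1 h2)
  have hY' : ∀ s, a ≤ s → s ≤ b → PairBound (2 * M * M) d 1 (Y' s) (Yt' s) := by
    intro s h1 h2
    have := (hFv s h1 h2).comp (hdr.deriv s (by linarith) (by linarith))
    rw [one_mul] at this
    rwa [h.deriv_eq s (by linarith) (by linarith), h.deriv_eq_t s (by linarith) (by linarith)]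
  have hN : 0 ≤ 1 + 2 * (2 * M * M) * M := by positivity
  have hY : ∀ s t, a ≤ s → s < t → t ≤ b →
      PairBound (incConst M) d ((t - s) ^ α) (Y t - Y s) (Yt t - Yt s) := by
    intro s t h1 h2 h3
    have hρ := hρ0 s t h2
    have i1 := (hY' s h1 (by linarith)).apply (hdr.path s t (by linarith) h2 (by linarith))
    rw [one_mul] at i1
    have i2 := hc.rem s t h1 h2 h3
    have i3 : L * ((t - s) ^ α * (t - s) ^ α) ≤ d * (t - s) ^ α := by
      rw [← mul_assoc]
      refine mul_le_mul_of_nonneg_right ?_ hρ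
      have := mul_le_mul_of_nonneg_left (hpow s t h1 h2 h3) hL
      linarith
    have hNρ := mul_nonneg hN hρ
    refine ⟨(h.inc s t (by linarith) h2 (by linarith)).trans ?_,
      (h.inc_t s t (by linarith) h2 (by linarith)).trans ?_, ?_⟩
    · unfold incConst; linarith
    · unfold incConst; linarith
    · have e1 : Y t - Y s - (Yt t - Yt s) = (Rem X Y Y' s t - Rem Xt Yt Yt' s t) +
          (Y' s (X t - X s) - Yt' s (Xt t - Xt s)) := by
        unfold Rem; abel
      rw [e1]
      refine (norm_add_le _ _).trans ((add_le_add (i2.trans i3) i1.2.2).trans ?_)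
      have := mul_nonneg (mul_nonneg hM0 hd0) hρ
      unfold incConst
      linarith
  have hFi : ∀ s t, a ≤ s → s < t → t ≤ b → PairBound (2 * M * incConst M) d ((t - s) ^ α)
      (F (Y t) - F (Y s)) (F (Yt t) - F (Yt s)) := fun s t h1 h2 h3 =>
    hF.pairBound_increment hM0 (hy s h1 (by linarith)) (hy t (by linarith) h3) (hY s t h1 h2 h3)
  have hDFi : ∀ s t, a ≤ s → s < t → t ≤ b → PairBound (2 * M * incConst M) d ((t - s) ^ α)
      (fderiv ℝ F (Y t) - fderiv ℝ F (Y s)) (fderiv ℝ F (Yt t) - fderiv ℝ F (Yt s)) :=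
    fun s t h1 h2 h3 =>
    hF'.pairBound_increment hM0 (hy s h1 (by linarith)) (hy t (by linarith) h3) (hY s t h1 h2 h3)
  have hY'i : ∀ s t, a ≤ s → s < t → t ≤ b → PairBound (derivConst M) d ((t - s) ^ α)
      (Y' t - Y' s) (Yt' t - Yt' s) := by
    intro s t h1 h2 h3
    have i1 := (hFi s t h1 h2 h3).comp (hdr.deriv t (by linarith) (by linarith))
    have i2 := (hFv s h1 (by linarith)).comp (hdr.deriv_inc s t (by linarith) h2 (by linarith))
    rw [mul_one] at i1
    rw [one_mul] at i2
    have i3 : PairBound (derivConst M) _ _ _ _ := i1.add i2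
    rw [h.deriv_eq s (by linarith) (by linarith), h.deriv_eq_t s (by linarith) (by linarith),
      h.deriv_eq t (by linarith) (by linarith), h.deriv_eq_t t (by linarith) (by linarith)]
    convert i3 using 1 <;> (ext; simp)
  set G : ℝ → V →L[ℝ] U →L[ℝ] W := fun r => (fderiv ℝ F (Y r)).comp (Y' r) with hG
  set Gt : ℝ → V →L[ℝ] U →L[ℝ] W := fun r => (fderiv ℝ F (Yt r)).comp (Yt' r) with hGt
  have hGv : ∀ s, a ≤ s → s ≤ b → PairBound (2 * M * (2 * M * M)) d 1 (G s) (Gt s) := by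
    intro s h1 h2
    have := (hDF s h1 h2).comp (hY' s h1 h2)
    rwa [one_mul] at this
  have hGi : ∀ s t, a ≤ s → s < t → t ≤ b → PairBound (integrandConst M) d ((t - s) ^ α)
      (G t - G s) (Gt t - Gt s) := by
    intro s t h1 h2 h3
    have i1 := (hDFi s t h1 h2 h3).comp (hY' t (by linarith) h3)
    have i2 := (hDF s h1 (by linarith)).comp (hY'i s t h1 h2 h3)
    rw [mul_one] at i1
    rw [one_mul] at i2
    have i3 : PairBound (integrandConst M) _ _ _ _ := i1.add i2
    convert i3 using 1 <;> (ext; simp [hG, hGt])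
  have hSv : ∀ s, a ≤ s → s ≤ b → PairBound (2 * (2 * M * (2 * M * M)) * M) d 1
      (tops.spair (G s) (Z' s)) (tops.spair (Gt s) (Zt' s)) := by
    intro s h1 h2
    have := (hGv s h1 h2).spair tops (hdr.deriv s (by linarith) (by linarith))
    rwa [one_mul] at this
  have hSi : ∀ s t, a ≤ s → s < t → t ≤ b → PairBound (pairingConst M) d ((t - s) ^ α)
      (tops.spair (G t) (Z' t) - tops.spair (G s) (Z' s))
      (tops.spair (Gt t) (Zt' t) - tops.spair (Gt s) (Zt' s)) := by
    intro s t h1 h2 h3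
    have i1 := (hGi s t h1 h2 h3).spair tops (hdr.deriv t (by linarith) (by linarith))
    have i2 := (hGv s h1 (by linarith)).spair tops
      (hdr.deriv_inc s t (by linarith) h2 (by linarith))
    rw [mul_one] at i1
    rw [one_mul] at i2
    have i3 : PairBound (pairingConst M) _ _ _ _ := i1.add i2
    convert i3 using 1 <;> simp
  have hRY : ∀ s t, a ≤ s → s < t → t ≤ b → PairBound M (e + L) ((t - s) ^ α * (t - s) ^ α)
      (Rem X Y Y' s t) (Rem Xt Yt Yt' s t) := by
    intro s t h1 h2 h3
    refine ⟨h.rem s t (by linarith) h2 (by linarith), h.rem_t s t (by linarith) h2 (by linarith),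
      (hc.rem s t h1 h2 h3).trans (mul_le_mul_of_nonneg_right ?_ (mul_self_nonneg _))⟩
    nlinarith
  have hRF : ∀ s t, a ≤ s → s < t → t ≤ b →
      PairBound (remConst M) (e + L) ((t - s) ^ α * (t - s) ^ α)
      (Rem X (fun r => F (Y r)) G s t) (Rem Xt (fun r => F (Yt r)) Gt s t) := by
    intro s t h1 h2 h3
    have i1 := (hF.pairBound_taylor hF' hM0 (hy s h1 (by linarith)) (hy t (by linarith) h3)
      (hY s t h1 h2 h3)).mono_dist (by have := incConst_nonneg hM0; positivity)
      (mul_self_nonneg _) hdl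
    have i2 := ((hDF s h1 (by linarith)).mono_dist hM0 zero_le_one hdl).apply (hRY s t h1 h2 h3)
    rw [one_mul] at i2
    have i3 : PairBound (remConst M) _ _ _ _ := i1.add i2
    convert i3 using 1 <;> simp [Rem, hG, hGt]
  have hN0 := incConst_nonneg hM0
  have hP0 := derivConst_nonneg hM0
  have hD0 := defectConst_nonneg hM0
  have hI0 : 0 ≤ integrandConst M := by unfold integrandConst; positivity
  have hQ0 : 0 ≤ pairingConst M := by unfold pairingConst; positivity
  have hR0 : 0 ≤ remConst M := by unfold remConst; positivity
  have hel : 0 ≤ e + L := by positivity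
  have hdl' := hd.mono hM0 (show e ≤ e + L by linarith)
  have hdefect : ∀ s u t, a ≤ s → s < u → u < t → t ≤ b →
      ‖(roughGerm tops XX (fun r => F (Y r)) G Z Z' s t -
        roughGerm tops XX (fun r => F (Y r)) G Z Z' s u -
        roughGerm tops XX (fun r => F (Y r)) G Z Z' u t) -
       (roughGerm tops XXt (fun r => F (Yt r)) Gt Zt Zt' s t -
        roughGerm tops XXt (fun r => F (Yt r)) Gt Zt Zt' s u -
        roughGerm tops XXt (fun r => F (Yt r)) Gt Zt Zt' u t)‖
      ≤ defectConst M * (e + L) * ((t - s) ^ α * ((t - s) ^ α * (t - s) ^ α)) := by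
    intro s u t h1 h2 h3 h4
    have p1 : (u - s) ^ α ≤ (t - s) ^ α :=
      Real.rpow_le_rpow (by linarith) (by linarith) (by linarith)
    have p2 : (t - u) ^ α ≤ (t - s) ^ α :=
      Real.rpow_le_rpow (by linarith) (by linarith) (by linarith)
    have p3 := mul_self_le_mul_self (hρ0 s u h2) p1
    have p4 := mul_self_le_mul_self (hρ0 u t h3) p2
    have key := PairBound.roughGerm_sub_sub tops (M := M) (d := e + L) (Y := fun r => F (Y r))
      (Yt := fun r => F (Yt r)) (Y' := G) (Yt' := Gt) (a₁ := 2 * M * incConst M)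
      (a₂ := remConst M) (a₃ := pairingConst M)
      (h.chen s u t (by linarith) h2.le h3.le (by linarith))
      (h.chen_t s u t (by linarith) h2.le h3.le (by linarith))
      ((hdl'.path u t (by linarith) h3 (by linarith)).mono_scale hM0 hel p2)
      ((hdl'.area u t (by linarith) h3 (by linarith)).mono_scale hM0 hel p4)
      (hdl'.deriv s (by linarith) (by linarith))
      ((hdl'.deriv_inc s u (by linarith) h2 (by linarith)).mono_scale hM0 hel p1)
      ((hdl'.rem u t (by linarith) h3 (by linarith)).mono_scale hM0 hel p4)
      (((hFi s u h1 h2 (by linarith)).mono_dist (by positivity) (hρ0 s u h2) hdl).mono_scale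
        (by positivity) hel p1)
      ((hRF s u h1 h2 (by linarith)).mono_scale hR0 hel p3)
      (((hSi s u h1 h2 (by linarith)).mono_dist hQ0 (hρ0 s u h2) hdl).mono_scale
        hQ0 hel p1)
    exact key.2.2
  have hsew0 := sewConst_nonneg (θ := 3 * α) (by linarith)
  set κ := sewConst (3 * α) * defectConst M + 2 * M * M +
    2 * (2 * (2 * M * (2 * M * M)) * M) * M with hκ
  have hκ0 : 0 ≤ κ := by positivity
  have hstep : stepConst α M = incConst M + derivConst M + κ := rfl
  refine ⟨fun s t h1 h2 h3 => (hY s t h1 h2 h3).2.2.trans ?_,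
    fun s t h1 h2 h3 => (hY'i s t h1 h2 h3).2.2.trans ?_, fun s t h1 h2 h3 => ?_⟩
  · have := hρ0 s t h2
    gcongr
    linarith
  · have := hρ0 s t h2
    gcongr
    linarith
  · have i1 := h.norm_increment_sub_germ_le hα ha hb hdefect h1 h2 h3
    have i2 := ((hFv s h1 (by linarith)).apply (hdr.rem s t (by linarith) h2 (by linarith))).2.2
    have i3 := ((hSv s h1 (by linarith)).apply (hdr.area s t (by linarith) h2 (by linarith))).2.2
    rw [one_mul] at i2 i3
    have hρ := hρ0 s t h2
    have hρη := hpow s t h1 h2 h3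
    have i4 : (e + L) * (t - s) ^ α ≤ d := by
      have := mul_le_mul_of_nonneg_left hρη hel
      have := mul_le_of_le_one_right he hη₁
      linarith
    have i5 : sewConst (3 * α) * (defectConst M * (e + L)) *
        ((t - s) ^ α * ((t - s) ^ α * (t - s) ^ α)) ≤
        sewConst (3 * α) * defectConst M * d * ((t - s) ^ α * (t - s) ^ α) := by
      have := mul_le_mul_of_nonneg_left i4
        (mul_nonneg (mul_nonneg hsew0 hD0) (mul_self_nonneg ((t - s) ^ α)))
      linarith
    have e1 : Rem X Y Y' s t - Rem Xt Yt Yt' s t =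
        ((Y t - Y s - roughGerm tops XX (fun r => F (Y r)) G Z Z' s t) -
          (Yt t - Yt s - roughGerm tops XXt (fun r => F (Yt r)) Gt Zt Zt' s t)) +
        (F (Y s) (Rem X Z Z' s t) - F (Yt s) (Rem Xt Zt Zt' s t)) +
        (tops.spair (G s) (Z' s) (XX s t) - tops.spair (Gt s) (Zt' s) (XXt s t)) := by
      simp only [Rem, roughGerm, h.deriv_eq s (by linarith) (by linarith),
        h.deriv_eq_t s (by linarith) (by linarith), ContinuousLinearMap.comp_apply, map_sub]
      abel
    rw [e1]
    refine (norm_add₃_le).trans ((add_le_add (add_le_add (i1.trans i5) i2) i3).trans ?_)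
    have := mul_nonneg (mul_nonneg (add_nonneg hN0 hP0) hd0) (mul_self_nonneg ((t - s) ^ α))
    rw [hstep, hκ]
    linarith

omit [NormedAddCommGroup V2] [NormedSpace ℝ V2] [NormedAddCommGroup U] [NormedSpace ℝ U] in
theorem CloseOn.of_tendsto {a b α L : ℝ} {l : ℕ → ℝ} {X Xt : ℝ → V} {Y Yt : ℝ → W}
    {Y' Yt' : ℝ → V →L[ℝ] W} (hl : Filter.Tendsto l Filter.atTop (nhds L))
    (h : ∀ n, CloseOn a b α (l n) X Xt Y Yt Y' Yt') : CloseOn a b α L X Xt Y Yt Y' Yt' :=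
  ⟨fun s t h1 h2 h3 => ge_of_tendsto' (hl.mul_const _) fun n => (h n).inc s t h1 h2 h3,
    fun s t h1 h2 h3 => ge_of_tendsto' (hl.mul_const _) fun n => (h n).deriv s t h1 h2 h3,
    fun s t h1 h2 h3 => ge_of_tendsto' (hl.mul_const _) fun n => (h n).rem s t h1 h2 h3⟩

theorem CloseOn.mono {a b a' b' α L L' : ℝ} {X Xt : ℝ → V} {Y Yt : ℝ → W}
    {Y' Yt' : ℝ → V →L[ℝ] W} (h : CloseOn a b α L X Xt Y Yt Y' Yt') (ha : a ≤ a') (hb : b' ≤ b)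
    (hL : L ≤ L') : CloseOn a' b' α L' X Xt Y Yt Y' Yt' :=
  ⟨fun s t h1 h2 h3 => (h.inc s t (ha.trans h1) h2 (h3.trans hb)).trans
      (mul_le_mul_of_nonneg_right hL (Real.rpow_nonneg (sub_nonneg.2 h2.le) _)),
    fun s t h1 h2 h3 => (h.deriv s t (ha.trans h1) h2 (h3.trans hb)).trans
      (mul_le_mul_of_nonneg_right hL (Real.rpow_nonneg (sub_nonneg.2 h2.le) _)),
    fun s t h1 h2 h3 => (h.rem s t (ha.trans h1) h2 (h3.trans hb)).trans
      (mul_le_mul_of_nonneg_right hL (mul_self_nonneg _))⟩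

theorem SolutionPair.closeOn_short {T α M a b e η L : ℝ} {tops : TensorOps V V2 U W}
    {F : W → U →L[ℝ] W} {X Xt : ℝ → V} {XX XXt : ℝ → ℝ → V2} {Z Zt : ℝ → U}
    {Z' Zt' : ℝ → V →L[ℝ] U} {Y Yt : ℝ → W} {Y' Yt' : ℝ → V →L[ℝ] W}
    (h : SolutionPair T α M tops F X Xt XX XXt Z Zt Z' Zt' Y Yt Y' Yt')
    (hd : DriverPair T α M e X Xt XX XXt Z Zt Z' Zt')
    (hF₀ : ∀ x, ‖F x‖ ≤ M) (hF : LipDeriv M F) (hF' : LipDeriv M (fderiv ℝ F))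
    (hα : 1 / 3 < α) (hM : 1 ≤ M) (ha : 0 ≤ a) (hb : b ≤ T)
    (hη : (b - a) ^ α ≤ η) (hη₀ : 0 ≤ η) (hη₁ : η ≤ 1) (hstep : stepConst α M * η ≤ 1 / 2)
    (hya : ‖Y a - Yt a‖ ≤ e) (hL : 0 ≤ L) (hc : CloseOn a b α L X Xt Y Yt Y' Yt') :
    CloseOn a b α (2 * stepConst α M * e) X Xt Y Yt Y' Yt' := by
  have he : 0 ≤ e := (norm_nonneg _).trans hya
  have hC : 0 ≤ stepConst α M := stepConst_nonneg hα (by linarith)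
  set C := stepConst α M
  have key : ∀ n : ℕ, CloseOn a b α (2 * C * e + L * (1 / 2) ^ n) X Xt Y Yt Y' Yt' := by
    intro n
    induction n with
    | zero => exact hc.mono le_rfl le_rfl (by simp; positivity)
    | succ n ih =>
      have hn : 0 ≤ 2 * C * e + L * (1 / 2) ^ n := by positivity
      refine (h.closeOn_step hd hF₀ hF hF' hα hM ha hb hη hη₀ hη₁ hya hn ih).mono le_rfl le_rfl ?_
      have := mul_le_mul_of_nonneg_right hstep hn
      rw [pow_succ]
      linarith
  refine CloseOn.of_tendsto ?_ key
  have h0 := tendsto_pow_atTop_nhds_zero_of_lt_one (r := (1 / 2 : ℝ)) (by norm_num) (by norm_num)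
  simpa using (h0.const_mul L).const_add (2 * C * e)

theorem SolutionPair.exists_closeOn (T α M : ℝ) (hα : 1 / 3 < α) (hM : 1 ≤ M)
    (tops : TensorOps V V2 U W) : ∃ C : ℝ, 0 < C ∧
    ∀ {e L : ℝ} {F : W → U →L[ℝ] W} {X Xt : ℝ → V} {XX XXt : ℝ → ℝ → V2} {Z Zt : ℝ → U}
      {Z' Zt' : ℝ → V →L[ℝ] U} {Y Yt : ℝ → W} {Y' Yt' : ℝ → V →L[ℝ] W},
      SolutionPair T α M tops F X Xt XX XXt Z Zt Z' Zt' Y Yt Y' Yt' →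
      DriverPair T α M e X Xt XX XXt Z Zt Z' Zt' →
      (∀ x, ‖F x‖ ≤ M) → LipDeriv M F → LipDeriv M (fderiv ℝ F) → ‖Y 0 - Yt 0‖ ≤ e →
      0 ≤ L → CloseOn 0 T α L X Xt Y Yt Y' Yt' →
      CloseOn 0 T α (C * e) X Xt Y Yt Y' Yt' := by
  have hM0 : 0 ≤ M := by linarith
  have hS : 0 ≤ stepConst α M := stepConst_nonneg hα hM0
  obtain ⟨S, hSdef⟩ : ∃ S, S = stepConst α M := ⟨_, rfl⟩
  rw [← hSdef] at hS
  obtain ⟨η, hηdef⟩ : ∃ η, η = 1 / (2 * S + 1) := ⟨_, rfl⟩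
  have hη0 : 0 < η := by rw [hηdef]; positivity
  have hη1 : η ≤ 1 := by
    rw [hηdef, div_le_one (by positivity)]
    linarith
  have hSη : S * η ≤ 1 / 2 := by
    rw [hηdef, mul_one_div, div_le_iff₀ (by positivity)]
    linarith
  obtain ⟨h, hh0, hhη⟩ : ∃ h : ℝ, 0 < h ∧ h ^ α = η :=
    ⟨η ^ (1 / α), Real.rpow_pos_of_pos hη0 _, by
      rw [← Real.rpow_mul hη0.le, one_div_mul_cancel (by linarith), Real.rpow_one]⟩
  obtain ⟨N, hN⟩ := exists_nat_ge (T / h)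
  rw [div_le_iff₀ hh0] at hN
  obtain ⟨B, hB⟩ : ∃ B, B = (1 + 2 * S) ^ N := ⟨_, rfl⟩
  have hB1 : 1 ≤ B := by rw [hB]; exact one_le_pow₀ (by linarith)
  obtain ⟨q, hq⟩ : ∃ q, q = 1 / η := ⟨_, rfl⟩
  have hq0 : 0 < q := by rw [hq]; positivity
  have hqη : q * η = 1 := by rw [hq]; field_simp
  refine ⟨B * (2 * S + 2 * q + 2 * (2 * M * M) * q + 2 * q * q + 2 * (2 * M * M) * M * q),
    by positivity, ?_⟩
  intro e L F X Xt XX XXt Z Zt Z' Zt' Y Yt Y' Yt' hs hd hF₀ hF hF' hy0 hL hc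
  have he : 0 ≤ e := (norm_nonneg _).trans hy0
  have hlocal : ∀ a b d, 0 ≤ a → a ≤ b → b ≤ T → b - a ≤ h → e ≤ d → ‖Y a - Yt a‖ ≤ d →
      CloseOn a b α (2 * S * d) X Xt Y Yt Y' Yt' := by
    intro a b d h1 h2 h3 h4 h5 h6
    rw [hSdef]
    refine hs.closeOn_short (hd.mono hM0 h5) hF₀ hF hF' hα hM h1 h3 ?_ hη0.le hη1
      (by rwa [← hSdef]) h6 hL (hc.mono h1 h3 le_rfl)
    rw [← hhη]
    exact Real.rpow_le_rpow (by linarith) h4 (by linarith)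
  have hsup : ∀ n : ℕ, ∀ t, 0 ≤ t → t ≤ T → t ≤ n * h →
      ‖Y t - Yt t‖ ≤ (1 + 2 * S) ^ n * e := by
    intro n
    induction n with
    | zero =>
      intro t h1 h2 h3
      obtain rfl : t = 0 := le_antisymm (by simpa using h3) h1
      simpa using hy0
    | succ n ih =>
      intro t h1 h2 h3
      have hp : 1 ≤ (1 + 2 * S) ^ n := one_le_pow₀ (by linarith)
      have hpe := mul_le_mul_of_nonneg_right hp he
      rw [one_mul] at hpe
      rw [pow_succ]
      rcases h1.eq_or_lt with rfl | h1
      · have : 0 ≤ (1 + 2 * S) ^ n * e * (2 * S) := by positivity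
        linarith
      · set a := max (t - h) 0 with ha
        have ha0 : 0 ≤ a := le_max_right _ _
        have hat : a < t := max_lt (by linarith) h1
        have hah : t - h ≤ a := le_max_left _ _
        have han : a ≤ n * h := max_le (by push_cast at h3; linarith) (by positivity)
        have hYa := ih a ha0 (by linarith) han
        have i1 := (hlocal a t _ ha0 hat.le h2 (by linarith) hpe hYa).inc a t le_rfl hat le_rfl
        have i2 : (t - a) ^ α ≤ 1 := by
          refine le_trans ?_ hη1
          rw [← hhη]
          exact Real.rpow_le_rpow (by linarith) (by linarith) (by linarith)
        have i3 := mul_le_mul_of_nonneg_left i2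
          (show 0 ≤ 2 * S * ((1 + 2 * S) ^ n * e) by positivity)
        have e1 : Y t - Yt t = (Y a - Yt a) + (Y t - Y a - (Yt t - Yt a)) := by abel
        rw [e1]
        exact (norm_add_le _ _).trans (by linarith)
  have hd' : ∀ t, 0 ≤ t → t ≤ T → ‖Y t - Yt t‖ ≤ B * e := fun t h1 h2 => by
    rw [hB]
    exact hsup N t h1 h2 (h2.trans hN)
  have heB : e ≤ B * e := le_mul_of_one_le_left he hB1
  have hBe : 0 ≤ B * e := he.trans heB
  have hdB := hd.mono hM0 heB
  have hY' : ∀ s, 0 ≤ s → s ≤ T → PairBound (2 * M * M) (B * e) 1 (Y' s) (Yt' s) := by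
    intro s h1 h2
    have := (PairBound.of_lipschitz hF₀ hM0 hF.norm_sub_le (hd' s h1 h2)).comp (hdB.deriv s h1 h2)
    rw [one_mul] at this
    rwa [hs.deriv_eq s h1 h2, hs.deriv_eq_t s h1 h2]
  have hlong : ∀ s t, h < t - s → 1 ≤ q * (t - s) ^ α := by
    intro s t hst
    rw [← hqη, ← hhη]
    exact mul_le_mul_of_nonneg_left (Real.rpow_le_rpow hh0.le hst.le (by linarith)) hq0.le
  have hshort : ∀ s t, 0 ≤ s → s < t → t ≤ T → t - s ≤ h →
      CloseOn s t α (B * (2 * S + 2 * q + 2 * (2 * M * M) * q + 2 * q * q +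
        2 * (2 * M * M) * M * q) * e) X Xt Y Yt Y' Yt' := fun s t h1 h2 h3 h4 => by
    refine (hlocal s t (B * e) h1 h2.le h3 h4 heB (hd' s h1 (by linarith))).mono le_rfl le_rfl ?_
    have : 0 ≤ B * e * (2 * q + 2 * (2 * M * M) * q + 2 * q * q +
        2 * (2 * M * M) * M * q) := by positivity
    linarith
  refine ⟨fun s t h1 h2 h3 => ?_, fun s t h1 h2 h3 => ?_, fun s t h1 h2 h3 => ?_⟩ <;>
    rcases le_or_gt (t - s) h with h4 | h4
  · exact (hshort s t h1 h2 h3 h4).inc s t le_rfl h2 le_rfl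
  · have i1 := hlong s t h4
    have hρ : 0 ≤ (t - s) ^ α := Real.rpow_nonneg (by linarith) _
    have i2 := hd' s h1 (by linarith)
    have i3 := hd' t (by linarith) h3
    have e1 : Y t - Y s - (Yt t - Yt s) = (Y t - Yt t) - (Y s - Yt s) := by abel
    rw [e1]
    refine (norm_sub_le _ _).trans ?_
    have i4 := mul_le_mul_of_nonneg_left i1 (show 0 ≤ 2 * (B * e) by positivity)
    have : 0 ≤ B * e * (2 * S + 2 * (2 * M * M) * q + 2 * q * q +
        2 * (2 * M * M) * M * q) * (t - s) ^ α := by positivity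
    linarith
  · exact (hshort s t h1 h2 h3 h4).deriv s t le_rfl h2 le_rfl
  · have i1 := hlong s t h4
    have hρ : 0 ≤ (t - s) ^ α := Real.rpow_nonneg (by linarith) _
    have i2 := (hY' s h1 (by linarith)).2.2
    have i3 := (hY' t (by linarith) h3).2.2
    have e1 : Y' t - Y' s - (Yt' t - Yt' s) = (Y' t - Yt' t) - (Y' s - Yt' s) := by abel
    rw [e1]
    refine (norm_sub_le _ _).trans ?_
    have i4 := mul_le_mul_of_nonneg_left i1 (show 0 ≤ 2 * (2 * M * M) * (B * e) by positivity)
    have : 0 ≤ B * e * (2 * S + 2 * q + 2 * q * q +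
        2 * (2 * M * M) * M * q) * (t - s) ^ α := by positivity
    linarith
  · exact (hshort s t h1 h2 h3 h4).rem s t le_rfl h2 le_rfl
  · have i1 := hlong s t h4
    have hρ : 0 ≤ (t - s) ^ α := Real.rpow_nonneg (by linarith) _
    have i2 := hd' s h1 (by linarith)
    have i3 := hd' t (by linarith) h3
    have i5 := ((hY' s h1 (by linarith)).apply (hdB.path s t h1 h2 h3)).2.2
    rw [one_mul] at i5
    have e1 : Rem X Y Y' s t - Rem Xt Yt Yt' s t = (Y t - Yt t) - (Y s - Yt s) -
        (Y' s (X t - X s) - Yt' s (Xt t - Xt s)) := by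
      unfold Rem; abel
    rw [e1]
    refine (norm_sub_le _ _).trans ((add_le_add_left (norm_sub_le _ _) _).trans ?_)
    have i4 := mul_le_mul_of_nonneg_left (mul_le_mul i1 i1 zero_le_one (by positivity))
      (show 0 ≤ 2 * (B * e) by positivity)
    have i6 := mul_le_mul_of_nonneg_left i1
      (show 0 ≤ 2 * (2 * M * M) * M * (B * e) * (t - s) ^ α by positivity)
    have : 0 ≤ B * e * (2 * S + 2 * q + 2 * (2 * M * M) * q) *
        ((t - s) ^ α * (t - s) ^ α) := by positivity
    linarith

end LocalEstimate

section HolderNorm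

variable {E : Type*} [NormedAddCommGroup E] {T β : ℝ} {A B : ℝ → ℝ → E}

theorem hnorm_nonneg : 0 ≤ hnorm T β A := Real.sInf_nonneg fun _ h => h.1

theorem HBound.norm_le (hA : HBound T β A) {s t : ℝ} (h0 : 0 ≤ s) (hst : s < t) (hT : t ≤ T) :
    ‖A s t‖ ≤ hnorm T β A * (t - s) ^ β := by
  obtain ⟨C, hC⟩ := hA
  have hr : 0 < (t - s) ^ β := Real.rpow_pos_of_pos (sub_pos.2 hst) _
  rw [← div_le_iff₀ hr]
  refine le_csInf ⟨|C|, abs_nonneg C, fun s t h1 h2 h3 => (hC s t h1 h2 h3).trans ?_⟩ ?_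
  · exact mul_le_mul_of_nonneg_right (le_abs_self C) (Real.rpow_nonneg (sub_nonneg.2 h2.le) _)
  · rintro D ⟨-, hD⟩
    rw [div_le_iff₀ hr]
    exact hD s t h0 hst hT

theorem HBound.norm_le_of_le (hA : HBound T β A) {K : ℝ} (hK : hnorm T β A ≤ K)
    {s t : ℝ} (h0 : 0 ≤ s) (hst : s < t) (hT : t ≤ T) : ‖A s t‖ ≤ K * (t - s) ^ β :=
  (hA.norm_le h0 hst hT).trans
    (mul_le_mul_of_nonneg_right hK (Real.rpow_nonneg (sub_nonneg.2 hst.le) _))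

theorem hnorm_le {C : ℝ} (hC : 0 ≤ C)
    (h : ∀ s t : ℝ, 0 ≤ s → s < t → t ≤ T → ‖A s t‖ ≤ C * (t - s) ^ β) : hnorm T β A ≤ C :=
  csInf_le ⟨0, fun _ h => h.1⟩ ⟨hC, h⟩

theorem HBound.sub (hA : HBound T β A) (hB : HBound T β B) :
    HBound T β fun s t => A s t - B s t := by
  obtain ⟨C, hC⟩ := hA
  obtain ⟨D, hD⟩ := hB
  refine ⟨C + D, fun s t h1 h2 h3 => (norm_sub_le _ _).trans ?_⟩
  rw [add_mul]
  exact add_le_add (hC s t h1 h2 h3) (hD s t h1 h2 h3)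

theorem PairBound.of_hnorm_le {K M e : ℝ} (hA : HBound T β A) (hB : HBound T β B)
    (hAK : hnorm T β A ≤ K) (hBK : hnorm T β B ≤ K)
    (hd : hnorm T β (fun s t => A s t - B s t) ≤ e) (hKM : K ≤ M) (hM : 1 ≤ M)
    {s t : ℝ} (h0 : 0 ≤ s) (hst : s < t) (hT : t ≤ T) :
    PairBound M e ((t - s) ^ β) (A s t) (B s t) :=
  ⟨hA.norm_le_of_le (hAK.trans hKM) h0 hst hT, hB.norm_le_of_le (hBK.trans hKM) h0 hst hT,
    (hA.sub hB).norm_le_of_le (hd.trans (le_mul_of_one_le_left (hnorm_nonneg.trans hd) hM))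
      h0 hst hT⟩

theorem norm_le_of_increment_le {g : ℝ → E} {c D : ℝ} (hT : 0 ≤ T) (hβ : 0 < β) (hD : 0 ≤ D)
    (h0 : ‖g 0‖ ≤ c)
    (h : ∀ s t : ℝ, 0 ≤ s → s < t → t ≤ T → ‖g t - g s‖ ≤ D * (t - s) ^ β)
    {s : ℝ} (hs : 0 ≤ s) (hsT : s ≤ T) : ‖g s‖ ≤ c + D * T ^ β := by
  rcases hs.eq_or_lt with rfl | hs
  · have := mul_nonneg hD (Real.rpow_nonneg hT β)
    linarith
  · have i1 := h 0 s le_rfl hs hsT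
    have i2 : (s - 0) ^ β ≤ T ^ β := Real.rpow_le_rpow (by linarith) (by linarith) hβ.le
    have i3 := mul_le_mul_of_nonneg_left i2 hD
    have := norm_le_norm_add_norm_sub (g 0) (g s)
    rw [norm_sub_rev] at this
    linarith

end HolderNorm

theorem IsCb.norm_iteratedFDeriv_le {E E₁ : Type*} [NormedAddCommGroup E] [NormedSpace ℝ E]
    [NormedAddCommGroup E₁] [NormedSpace ℝ E₁] {k : ℕ} {F : E → E₁} (hF : IsCb k F) {j : ℕ}
    (hj : j ≤ k) (x : E) : ‖iteratedFDeriv ℝ j F x‖ ≤ cbNorm k F := by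
  obtain ⟨C, hC⟩ := hF.2 j hj
  have h1 : ‖iteratedFDeriv ℝ j F x‖ ≤ ⨆ x : E, ‖iteratedFDeriv ℝ j F x‖ :=
    le_ciSup (f := fun x => ‖iteratedFDeriv ℝ j F x‖)
      ⟨C, by rintro _ ⟨x, rfl⟩; exact hC x⟩ x
  exact h1.trans (Finset.single_le_sum
    (f := fun j => ⨆ x : E, ‖iteratedFDeriv ℝ j F x‖)
    (fun i _ => Real.iSup_nonneg fun _ => norm_nonneg _)
    (Finset.mem_range.2 (Nat.lt_succ_of_le hj)))

theorem LipDeriv.of_norm_iteratedFDeriv_le {E E₁ : Type*} [NormedAddCommGroup E] [NormedSpace ℝ E]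
    [NormedAddCommGroup E₁] [NormedSpace ℝ E₁] {M : ℝ} {G : E → E₁} (hG : ContDiff ℝ 2 G)
    (h₁ : ∀ x, ‖iteratedFDeriv ℝ 1 G x‖ ≤ M) (h₂ : ∀ x, ‖iteratedFDeriv ℝ 2 G x‖ ≤ M) :
    LipDeriv M G := by
  have hG' : ContDiff ℝ 1 (fderiv ℝ G) := hG.fderiv_right (by norm_num)
  refine ⟨hG.differentiable (by norm_num), fun x => ?_, fun x y => ?_⟩
  · rw [← norm_iteratedFDeriv_one]
    exact h₁ x
  · refine convex_univ.norm_image_sub_le_of_norm_fderiv_le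
      (fun x _ => hG'.differentiable (by norm_num) x) (fun x _ => ?_)
      (Set.mem_univ y) (Set.mem_univ x)
    rw [← norm_iteratedFDeriv_one, norm_iteratedFDeriv_fderiv]
    exact h₂ x

/-- universal limit theorem for rough differential equations
driven by controlled rough paths. -/
theorem stmt18
    {V V2 W U : Type*} [NormedAddCommGroup V] [NormedSpace ℝ V] [CompleteSpace V]
    [NormedAddCommGroup V2] [NormedSpace ℝ V2] [CompleteSpace V2]
    [NormedAddCommGroup W] [NormedSpace ℝ W] [CompleteSpace W]
    [NormedAddCommGroup U] [NormedSpace ℝ U] [CompleteSpace U]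
    (T α : ℝ) (hT : 0 < T) (hα : 1 / 3 < α) (hα' : α ≤ 1 / 2)
    (tops : TensorOps V V2 U W) :
    ∀ K : ℝ, 0 < K → ∃ C : ℝ, 0 < C ∧
      ∀ (X Xt : ℝ → V) (XX XXt : ℝ → ℝ → V2),
        IsRoughPath T α tops.tmul X XX → IsRoughPath T α tops.tmul Xt XXt →
        rpNorm T α X XX ≤ K → rpNorm T α Xt XXt ≤ K →
      ∀ F : W → U →L[ℝ] W, IsCb 3 F → cbNorm 3 F ≤ K →
      ∀ (Z Zt : ℝ → U) (Z' Zt' : ℝ → V →L[ℝ] U),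
        IsCRP T α X Z Z' → IsCRP T α Xt Zt Zt' →
        ‖Z' 0‖ ≤ K → ‖Zt' 0‖ ≤ K →
        crpNorm T α X Z Z' ≤ K → crpNorm T α Xt Zt Zt' ≤ K →
      ∀ (Y Yt : ℝ → W) (Y' Yt' : ℝ → V →L[ℝ] W),
        IsCRP T α X Y Y' → IsCRP T α Xt Yt Yt' →
        (∀ t : ℝ, 0 ≤ t → t ≤ T → Y' t = (F (Y t)).comp (Z' t)) →
        (∀ t : ℝ, 0 ≤ t → t ≤ T →
          IsRoughIntegral tops XX (fun r => F (Y r))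
            (fun r => (fderiv ℝ F (Y r)).comp (Y' r)) Z Z' 0 t (Y t - Y 0)) →
        (∀ t : ℝ, 0 ≤ t → t ≤ T → Yt' t = (F (Yt t)).comp (Zt' t)) →
        (∀ t : ℝ, 0 ≤ t → t ≤ T →
          IsRoughIntegral tops XXt (fun r => F (Yt r))
            (fun r => (fderiv ℝ F (Yt r)).comp (Yt' r)) Zt Zt' 0 t (Yt t - Yt 0)) →
        ‖Y' 0‖ ≤ K → ‖Yt' 0‖ ≤ K →
        crpNorm T α X Y Y' ≤ K → crpNorm T α Xt Yt Yt' ≤ K →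
        crpDist T α X Xt Y Y' Yt Yt' ≤
          C * (‖Y 0 - Yt 0‖ + ‖Y' 0 - Yt' 0‖ + ‖Z 0 - Zt 0‖ + ‖Z' 0 - Zt' 0‖ +
            crpDist T α X Xt Z Z' Zt Zt' + rpDist T α X Xt XX XXt) := by
  intro K hK
  have hα0 : 0 < α := by linarith
  set τ := T ^ α with hτ
  have hτ0 : 0 < τ := Real.rpow_pos_of_pos hT α
  set M := 1 + τ + (K + K * τ) + (K * τ + (K + K * τ) * K) with hMdef
  have p1 : 0 < K * τ := mul_pos hK hτ0
  have p2 : 0 < (K + K * τ) * K := by positivity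
  have hM1 : 1 ≤ M := by linarith
  have hM0 : 0 ≤ M := by linarith
  have hKM : K ≤ M := by linarith
  obtain ⟨C, hC, hmain⟩ := SolutionPair.exists_closeOn T α M hα hM1 tops
  refine ⟨2 * C, by positivity, ?_⟩
  intro X Xt XX XXt hX hXt hXK hXtK F hF hFK Z Zt Z' Zt' hZ hZt hZ0 hZt0 hZK hZtK
    Y Yt Y' Yt' hY hYt hY' hYi hYt' hYti hY0 hYt0 hYK hYtK
  set e := ‖Y 0 - Yt 0‖ + ‖Y' 0 - Yt' 0‖ + ‖Z 0 - Zt 0‖ + ‖Z' 0 - Zt' 0‖ +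
    crpDist T α X Xt Z Z' Zt Zt' + rpDist T α X Xt XX XXt with he
  have q1 := norm_nonneg (Y 0 - Yt 0)
  have q2 := norm_nonneg (Y' 0 - Yt' 0)
  have q3 := norm_nonneg (Z 0 - Zt 0)
  have q4 := norm_nonneg (Z' 0 - Zt' 0)
  have q5 := hnorm_nonneg (T := T) (β := 2 * α)
    (A := fun s t => Rem X Z Z' s t - Rem Xt Zt Zt' s t)
  have q6 := hnorm_nonneg (T := T) (β := α) (A := fun s t => (Z' t - Z' s) - (Zt' t - Zt' s))
  have q7 := hnorm_nonneg (T := T) (β := α) (A := fun s t => (X t - X s) - (Xt t - Xt s))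
  have q8 := hnorm_nonneg (T := T) (β := 2 * α) (A := fun s t => XX s t - XXt s t)
  have splitX : ∀ {x : ℝ → V} {xx : ℝ → ℝ → V2}, rpNorm T α x xx ≤ K →
      hnorm T α (fun s t => x t - x s) ≤ K ∧ hnorm T (2 * α) xx ≤ K := fun {x xx} h => by
    unfold rpNorm at h
    have h1 := hnorm_nonneg (T := T) (β := α) (A := fun s t => x t - x s)
    have h2 := hnorm_nonneg (T := T) (β := 2 * α) (A := xx)
    constructor <;> linarith
  have splitZ : ∀ {x : ℝ → V} {z : ℝ → U} {z' : ℝ → V →L[ℝ] U}, crpNorm T α x z z' ≤ K →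
      hnorm T (2 * α) (Rem x z z') ≤ K ∧ hnorm T α (fun s t => z' t - z' s) ≤ K :=
    fun {x z z'} h => by
    unfold crpNorm at h
    have h1 := hnorm_nonneg (T := T) (β := 2 * α) (A := Rem x z z')
    have h2 := hnorm_nonneg (T := T) (β := α) (A := fun s t => z' t - z' s)
    constructor <;> linarith
  have splitY : ∀ {x : ℝ → V} {z : ℝ → W} {z' : ℝ → V →L[ℝ] W}, crpNorm T α x z z' ≤ K →
      hnorm T (2 * α) (Rem x z z') ≤ K ∧ hnorm T α (fun s t => z' t - z' s) ≤ K :=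
    fun {x z z'} h => by
    unfold crpNorm at h
    have h1 := hnorm_nonneg (T := T) (β := 2 * α) (A := Rem x z z')
    have h2 := hnorm_nonneg (T := T) (β := α) (A := fun s t => z' t - z' s)
    constructor <;> linarith
  unfold crpDist rpDist at he
  have he0 : 0 ≤ e := by linarith
  have hpair : DriverPair T α M e X Xt XX XXt Z Zt Z' Zt' := by
    refine ⟨fun s t h1 h2 h3 => ?_, fun s t h1 h2 h3 => ?_, fun s h1 h2 => ?_,
      fun s t h1 h2 h3 => ?_, fun s t h1 h2 h3 => ?_⟩
    · exact PairBound.of_hnorm_le hX.x_hold hXt.x_hold (splitX hXK).1 (splitX hXtK).1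
        (by linarith) hKM hM1 h1 h2 h3
    · rw [← rpow_two_mul (sub_pos.2 h2)]
      exact PairBound.of_hnorm_le hX.xx_hold hXt.xx_hold (splitX hXK).2 (splitX hXtK).2
        (by linarith) hKM hM1 h1 h2 h3
    · have i1 := norm_le_of_increment_le hT.le hα0 hK.le hZ0 (fun s t h1 h2 h3 =>
        hZ.deriv_hold.norm_le_of_le (splitZ hZK).2 h1 h2 h3) h1 h2
      have i2 := norm_le_of_increment_le hT.le hα0 hK.le hZt0 (fun s t h1 h2 h3 =>
        hZt.deriv_hold.norm_le_of_le (splitZ hZtK).2 h1 h2 h3) h1 h2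
      have i3 := norm_le_of_increment_le (g := fun s => Z' s - Zt' s) (c := e) (D := e)
        hT.le hα0 he0 (by linarith) (fun s t h1 h2 h3 => by
          rw [sub_sub_sub_comm]
          exact (hZ.deriv_hold.sub hZt.deriv_hold).norm_le_of_le (by linarith) h1 h2 h3) h1 h2
      refine ⟨by linarith, by linarith, ?_⟩
      have : 0 ≤ (M - 1 - τ) * e := mul_nonneg (by linarith) he0
      linarith
    · exact PairBound.of_hnorm_le hZ.deriv_hold hZt.deriv_hold (splitZ hZK).2 (splitZ hZtK).2
        (by linarith) hKM hM1 h1 h2 h3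
    · rw [← rpow_two_mul (sub_pos.2 h2)]
      exact PairBound.of_hnorm_le hZ.rem_hold hZt.rem_hold (splitZ hZK).1 (splitZ hZtK).1
        (by linarith) hKM hM1 h1 h2 h3
  have hrem : ∀ {x : ℝ → V} {y : ℝ → W} {y' : ℝ → V →L[ℝ] W}, IsCRP T α x y y' →
      crpNorm T α x y y' ≤ K → ∀ s t, 0 ≤ s → s < t → t ≤ T →
      ‖Rem x y y' s t‖ ≤ M * ((t - s) ^ α * (t - s) ^ α) := by
    intro x y y' hy hyK s t h1 h2 h3
    rw [← rpow_two_mul (sub_pos.2 h2)]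
    exact hy.rem_hold.norm_le_of_le ((splitY hyK).1.trans hKM) h1 h2 h3
  have hinc : ∀ {x : ℝ → V} {xx : ℝ → ℝ → V2} {y : ℝ → W} {y' : ℝ → V →L[ℝ] W},
      IsRoughPath T α tops.tmul x xx → rpNorm T α x xx ≤ K → IsCRP T α x y y' →
      crpNorm T α x y y' ≤ K → ‖y' 0‖ ≤ K → ∀ s t, 0 ≤ s → s < t → t ≤ T →
      ‖y t - y s‖ ≤ M * (t - s) ^ α := by
    intro x xx y y' hx hxK hy hyK hy0 s t h1 h2 h3
    have i1 := hy.rem_hold.norm_le_of_le (splitY hyK).1 h1 h2 h3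
    rw [rpow_two_mul (sub_pos.2 h2)] at i1
    have i2 := hx.x_hold.norm_le_of_le (splitX hxK).1 h1 h2 h3
    have i3 := norm_le_of_increment_le hT.le hα0 hK.le hy0 (fun s t h1 h2 h3 =>
      hy.deriv_hold.norm_le_of_le (splitY hyK).2 h1 h2 h3) h1 (h2.le.trans h3)
    have hρ : 0 ≤ (t - s) ^ α := Real.rpow_nonneg (by linarith) _
    have i4 : (t - s) ^ α ≤ τ := Real.rpow_le_rpow (by linarith) (by linarith) hα0.le
    have i5 := (y' s).le_opNorm (x t - x s)
    have i6 := mul_le_mul i3 i2 (norm_nonneg _) (by positivity)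
    have i7 := mul_le_mul_of_nonneg_left (mul_le_mul_of_nonneg_right i4 hρ) hK.le
    have e1 : y t - y s = Rem x y y' s t + y' s (x t - x s) := by unfold Rem; abel
    rw [e1]
    refine (norm_add_le _ _).trans ?_
    have : 0 ≤ (1 + τ + (K + K * τ)) * (t - s) ^ α := by positivity
    rw [hMdef]
    linarith
  have hsol : SolutionPair T α M tops F X Xt XX XXt Z Zt Z' Zt' Y Yt Y' Yt' :=
    ⟨hX.chen, hXt.chen, hY', hYt', hYi, hYti, hinc hX hXK hY hYK hY0,
      hinc hXt hXtK hYt hYtK hYt0, hrem hY hYK, hrem hYt hYtK⟩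
  have hF3 : ContDiff ℝ 3 F := hF.1
  have hFj : ∀ j ≤ 3, ∀ x, ‖iteratedFDeriv ℝ j F x‖ ≤ M := fun j hj x =>
    (hF.norm_iteratedFDeriv_le hj x).trans (hFK.trans hKM)
  have hF₀ : ∀ x, ‖F x‖ ≤ M := fun x => by
    rw [← norm_iteratedFDeriv_zero (𝕜 := ℝ)]
    exact hFj 0 (by norm_num) x
  have hF₁ : LipDeriv M F := LipDeriv.of_norm_iteratedFDeriv_le (hF3.of_le (by norm_num))
    (hFj 1 (by norm_num)) (hFj 2 (by norm_num))
  have hF₂ : LipDeriv M (fderiv ℝ F) :=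
    LipDeriv.of_norm_iteratedFDeriv_le (hF3.fderiv_right (by norm_num))
      (fun x => by rw [norm_iteratedFDeriv_fderiv]; exact hFj 2 (by norm_num) x)
      (fun x => by rw [norm_iteratedFDeriv_fderiv]; exact hFj 3 (by norm_num) x)
  have hcrude : CloseOn 0 T α (2 * M) X Xt Y Yt Y' Yt' := by
    refine ⟨fun s t h1 h2 h3 => (norm_sub_le _ _).trans ?_,
      fun s t h1 h2 h3 => (norm_sub_le _ _).trans ?_,
      fun s t h1 h2 h3 => (norm_sub_le _ _).trans ?_⟩
    · have := hsol.inc s t h1 h2 h3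
      have := hsol.inc_t s t h1 h2 h3
      linarith
    · have := hY.deriv_hold.norm_le_of_le ((splitY hYK).2.trans hKM) h1 h2 h3
      have := hYt.deriv_hold.norm_le_of_le ((splitY hYtK).2.trans hKM) h1 h2 h3
      linarith
    · have := hsol.rem s t h1 h2 h3
      have := hsol.rem_t s t h1 h2 h3
      linarith
  have hclose := hmain hsol hpair hF₀ hF₁ hF₂ (by linarith) (by positivity) hcrude
  have hCe : 0 ≤ C * e := by positivity
  have r1 := hnorm_le (T := T) (β := 2 * α)
    (A := fun s t => Rem X Y Y' s t - Rem Xt Yt Yt' s t) hCe fun s t h1 h2 h3 => by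
      rw [rpow_two_mul (sub_pos.2 h2)]
      exact hclose.rem s t h1 h2 h3
  have r2 := hnorm_le (T := T) (β := α)
    (A := fun s t => (Y' t - Y' s) - (Yt' t - Yt' s)) hCe hclose.deriv
  unfold crpDist
  linarith
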